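/- Let 0 < s + α < 1, Q/(Q+s) < p < ∞ and 0 < q < ∞. Then there exists C > 0 such that ‖M*_α u‖_{Ṅ^{s+α}_{p,q}(X)} ≤ C ‖u‖_{Ṅ^s_{p,q}(X)} for all u in the homogeneous Hajłasz–Besov space Ṅ^s_{p,q}(X) with M*_α u not identically infinite. -/

import Mathlib

open MeasureTheory Metric ENNReal

namespace FracMaximal

variable {X : Type*}

/-- The measure `μ` is doubling with constant `c`. -/
def IsDoubling [PseudoMetricSpace X] [MeasurableSpace X] (μ : Measure X) (c : ℝ≥0∞) : Prop :=
  ∀ (x : X) (r : ℝ), 0 < r → μ (ball x (2 * r)) ≤ c * μ (ball x r)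

/-- Lower dimension bound: `μ(B(y,r))/μ(B(x,R)) ≥ c (r/R)^Q`. -/
def DimLowerBound [PseudoMetricSpace X] [MeasurableSpace X] (μ : Measure X) (c Q : ℝ) : Prop :=
  ∀ (x y : X) (r R : ℝ), 0 < r → r ≤ R → y ∈ ball x R →
    ENNReal.ofReal (c * (r / R) ^ Q) * μ (ball x R) ≤ μ (ball y r)

/-- The fractional maximal function `M_α u(x) = sup_{r>0} r^α ⨍_{B(x,r)} |u| dμ`. -/
noncomputable def fracMax [PseudoMetricSpace X] [MeasurableSpace X] (μ : Measure X) (α : ℝ)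
    (u : X → ℝ) (x : X) : ℝ≥0∞ :=
  ⨆ (r : ℝ) (_ : 0 < r), ENNReal.ofReal (r ^ α) * ⨍⁻ y in ball x r, ‖u y‖₊ ∂μ

/-- `g` is an `s`-Hajłasz gradient of `u`. -/
def IsHajlaszGradient [PseudoMetricSpace X] [MeasurableSpace X] (μ : Measure X) (s : ℝ)
    (u g : X → ℝ) : Prop :=
  Measurable g ∧ (∀ x, 0 ≤ g x) ∧ ∃ E : Set X, μ E = 0 ∧
    ∀ x ∉ E, ∀ y ∉ E, |u x - u y| ≤ dist x y ^ s * (g x + g y)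

/-- The homogeneous Hajłasz space (quasi)norm `‖u‖_{Ṁ^{s,p}}`. -/
noncomputable def hajlaszNorm [PseudoMetricSpace X] [MeasurableSpace X] (μ : Measure X)
    (s p : ℝ) (u : X → ℝ) : ℝ≥0∞ :=
  ⨅ (g : X → ℝ) (_ : IsHajlaszGradient μ s u g), eLpNorm g (ENNReal.ofReal p) μ

/-- `(g k)` is a fractional `s`-Hajłasz gradient of `u`. -/
def IsFracHajlaszGradient [PseudoMetricSpace X] [MeasurableSpace X] (μ : Measure X) (s : ℝ)
    (u : X → ℝ) (g : ℤ → X → ℝ) : Prop :=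
  (∀ k, Measurable (g k)) ∧ (∀ k x, 0 ≤ g k x) ∧ ∃ E : Set X, μ E = 0 ∧
    ∀ (k : ℤ), ∀ x ∉ E, ∀ y ∉ E,
      (2 : ℝ) ^ (-k - 1) ≤ dist x y → dist x y < (2 : ℝ) ^ (-k) →
        |u x - u y| ≤ dist x y ^ s * (g k x + g k y)

/-- Homogeneous Hajłasz--Triebel--Lizorkin (quasi)norm `‖u‖_{Ṁ^s_{p,q}}`. -/
noncomputable def tlNorm [PseudoMetricSpace X] [MeasurableSpace X] (μ : Measure X)
    (s p q : ℝ) (u : X → ℝ) : ℝ≥0∞ :=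
  ⨅ (g : ℤ → X → ℝ) (_ : IsFracHajlaszGradient μ s u g),
    (∫⁻ x, (∑' k : ℤ, ENNReal.ofReal (g k x ^ q)) ^ (p / q) ∂μ) ^ (1 / p)

/-- Homogeneous Hajłasz--Besov (quasi)norm `‖u‖_{Ṅ^s_{p,q}}`. -/
noncomputable def besovNorm [PseudoMetricSpace X] [MeasurableSpace X] (μ : Measure X)
    (s p q : ℝ) (u : X → ℝ) : ℝ≥0∞ :=
  ⨅ (g : ℤ → X → ℝ) (_ : IsFracHajlaszGradient μ s u g),
    (∑' k : ℤ, (eLpNorm (g k) (ENNReal.ofReal p) μ) ^ q) ^ (1 / q)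

/-- Data for the discrete (fractional) maximal operator: for each positive rational scale `r`,
a covering of `X` by balls `B(x_i, r)` whose dilations `B(x_i, 6r)` have bounded overlap,
together with a Lipschitz partition of unity subordinate to the covering. -/
structure DiscreteMaxData (X : Type*) [PseudoMetricSpace X] where
  center : ℚ → ℕ → X
  φ : ℚ → ℕ → X → ℝ
  N : ℕ
  ν : ℝ
  L : ℝ
  ν_pos : 0 < ν
  L_pos : 0 < L
  cover : ∀ r : ℚ, 0 < r → ∀ x : X, ∃ i, x ∈ ball (center r i) (r : ℝ)
  overlap : ∀ r : ℚ, 0 < r → ∀ x : X,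
    ∑' i : ℕ, (ball (center r i) (6 * (r : ℝ))).indicator (fun _ => (1 : ℝ≥0∞)) x ≤ N
  φ_nonneg : ∀ r i x, 0 ≤ φ r i x
  φ_le_one : ∀ r i x, φ r i x ≤ 1
  φ_supp : ∀ r : ℚ, 0 < r → ∀ i x, x ∉ ball (center r i) (6 * (r : ℝ)) → φ r i x = 0
  φ_lower : ∀ r : ℚ, 0 < r → ∀ i x, x ∈ ball (center r i) (3 * (r : ℝ)) → ν ≤ φ r i x
  φ_lip : ∀ r : ℚ, 0 < r → ∀ i, LipschitzWith (Real.toNNReal (L / (r : ℝ))) (φ r i)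
  φ_sum : ∀ r : ℚ, 0 < r → ∀ x, ∑' i, φ r i x = 1

/-- The discrete fractional maximal function `M*_α u = sup_j r_j^α |u|_{r_j}`, where
`|u|_r(x) = Σ_i φ_i(x) ⨍_{B(x_i,3r)} |u| dμ` is the discrete convolution at scale `3r`. -/
noncomputable def DiscreteMaxData.dMax [PseudoMetricSpace X] [MeasurableSpace X]
    (D : DiscreteMaxData X) (μ : Measure X) (α : ℝ) (u : X → ℝ) (x : X) : ℝ≥0∞ :=
  ⨆ (r : ℚ) (_ : 0 < r), ENNReal.ofReal ((r : ℝ) ^ α) *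
    ∑' i : ℕ, ENNReal.ofReal (D.φ r i x) *
      ⨍⁻ y in ball (D.center r i) (3 * (r : ℝ)), ‖u y‖₊ ∂μ

/-- The geometric weight `2^{-δ|n|}` on the integers. -/
noncomputable def geomWeight (δ : ℝ) (n : ℤ) : ℝ≥0∞ :=
  ENNReal.ofReal ((2 : ℝ) ^ (-(δ * |(n : ℝ)|)))

lemma geomWeight_ne_top (δ : ℝ) (n : ℤ) : geomWeight δ n ≠ ⊤ := ENNReal.ofReal_ne_top

lemma geomWeight_anti {δ δ' : ℝ} (h : δ ≤ δ') (n : ℤ) : geomWeight δ' n ≤ geomWeight δ n := by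
  refine ENNReal.ofReal_le_ofReal (Real.rpow_le_rpow_of_exponent_le (by norm_num) ?_)
  have := mul_le_mul_of_nonneg_right h (abs_nonneg (n : ℝ))
  linarith

lemma geomWeight_mul (δ δ' : ℝ) (n : ℤ) :
    geomWeight δ n * geomWeight δ' n = geomWeight (δ + δ') n := by
  unfold geomWeight
  rw [← ENNReal.ofReal_mul (by positivity), ← Real.rpow_add (by norm_num)]
  ring_nf

lemma geomWeight_rpow (δ P : ℝ) (hP : 0 ≤ P) (n : ℤ) :
    geomWeight δ n ^ P = geomWeight (δ * P) n := by
  unfold geomWeight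
  rw [ENNReal.ofReal_rpow_of_nonneg (by positivity) hP, ← Real.rpow_mul (by norm_num)]
  ring_nf

lemma geomWeight_mul_le {δ : ℝ} (hδ : 0 ≤ δ) (m n : ℤ) :
    geomWeight δ m * geomWeight δ n ≤ geomWeight δ (m + n) := by
  unfold geomWeight
  rw [← ENNReal.ofReal_mul (by positivity), ← Real.rpow_add (by norm_num)]
  refine ENNReal.ofReal_le_ofReal (Real.rpow_le_rpow_of_exponent_le (by norm_num) ?_)
  have h := mul_le_mul_of_nonneg_left (abs_add_le (m : ℝ) n) hδ
  push_cast
  linarith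

lemma tsum_geomWeight_ne_top {δ : ℝ} (hδ : 0 < δ) : ∑' n : ℤ, geomWeight δ n ≠ ⊤ := by
  have h0 : (2 : ℝ) ^ (-δ) < 1 := Real.rpow_lt_one_of_one_lt_of_neg (by norm_num) (by linarith)
  have hg : Summable fun n : ℕ => ((2 : ℝ) ^ (-δ)) ^ n :=
    summable_geometric_of_lt_one (by positivity) h0
  have key : ∀ n : ℕ, ((2 : ℝ) ^ (-δ)) ^ n = (2 : ℝ) ^ (-(δ * |((n : ℤ) : ℝ)|)) := by
    intro n
    rw [← Real.rpow_natCast, ← Real.rpow_mul (by norm_num)]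
    congr 1
    simp
  have hs : Summable fun n : ℤ => (2 : ℝ) ^ (-(δ * |(n : ℝ)|)) := by
    refine Summable.of_nat_of_neg ?_ ?_
    · simpa only [key] using hg
    · simpa only [key, Int.cast_neg, abs_neg] using hg
  unfold geomWeight
  rw [← ENNReal.ofReal_tsum_of_nonneg (fun n => by positivity) hs]
  exact ENNReal.ofReal_ne_top

lemma tsum_geomWeight_sub (δ : ℝ) (k : ℤ) :
    ∑' n : ℤ, geomWeight δ (n - k) = ∑' n : ℤ, geomWeight δ n :=
  (Equiv.subRight k).tsum_eq (geomWeight δ)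

lemma tsum_geomWeight_sub' (δ : ℝ) (k : ℤ) :
    ∑' n : ℤ, geomWeight δ (k - n) = ∑' n : ℤ, geomWeight δ n :=
  (Equiv.subLeft k).tsum_eq (geomWeight δ)

/-- A geometrically weighted sum raised to any positive power is controlled by the geometrically
weighted sum of the powers. -/
lemma exists_tsum_geomWeight_rpow_le {δ P : ℝ} (hδ : 0 < δ) (hP : 0 < P) :
    ∃ C : ℝ≥0∞, C ≠ ⊤ ∧ ∀ (a : ℤ → ℝ≥0∞) (k : ℤ),
      (∑' j, geomWeight δ (j - k) * a j) ^ P ≤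
        C * ∑' j, geomWeight (δ / 2 * P) (j - k) * a j ^ P := by
  refine ⟨(∑' n : ℤ, geomWeight (δ / 2) n) ^ P,
    ENNReal.rpow_ne_top_of_nonneg hP.le (tsum_geomWeight_ne_top (by linarith)), fun a k => ?_⟩
  set S := ⨆ j, geomWeight (δ / 2) (j - k) * a j with hS
  have h1 : ∑' j, geomWeight δ (j - k) * a j ≤ (∑' n : ℤ, geomWeight (δ / 2) n) * S := by
    rw [← tsum_geomWeight_sub (δ / 2) k, ← ENNReal.tsum_mul_right]
    refine ENNReal.tsum_le_tsum fun j => ?_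
    have : geomWeight δ (j - k) = geomWeight (δ / 2) (j - k) * geomWeight (δ / 2) (j - k) := by
      rw [geomWeight_mul]; ring_nf
    rw [this, mul_assoc]
    gcongr
    exact le_iSup (fun j => geomWeight (δ / 2) (j - k) * a j) j
  have h2 : S ^ P ≤ ∑' j, geomWeight (δ / 2 * P) (j - k) * a j ^ P := by
    have : S ≤ (∑' j, geomWeight (δ / 2 * P) (j - k) * a j ^ P) ^ (1 / P) := by
      refine iSup_le fun j => ?_
      rw [one_div, ENNReal.le_rpow_inv_iff hP, ENNReal.mul_rpow_of_nonneg _ _ hP.le,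
        geomWeight_rpow _ _ hP.le]
      exact ENNReal.le_tsum (f := fun j => geomWeight (δ / 2 * P) (j - k) * a j ^ P) j
    rwa [one_div, ENNReal.le_rpow_inv_iff hP] at this
  calc _ ≤ ((∑' n : ℤ, geomWeight (δ / 2) n) * S) ^ P := by gcongr
    _ = (∑' n : ℤ, geomWeight (δ / 2) n) ^ P * S ^ P := ENNReal.mul_rpow_of_nonneg _ _ hP.le
    _ ≤ _ := by gcongr

/-- Two successive geometrically weighted sums collapse to a single one. -/
lemma tsum_tsum_geomWeight_le {δ : ℝ} (hδ : 0 < δ) (a : ℤ → ℝ≥0∞) (k : ℤ) :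
    ∑' m, geomWeight δ (m - k) * ∑' j, geomWeight δ (j - m) * a j ≤
      (∑' n : ℤ, geomWeight (δ / 2) n) * ∑' j, geomWeight (δ / 2) (j - k) * a j := by
  simp_rw [← ENNReal.tsum_mul_left]
  rw [ENNReal.tsum_comm]
  refine ENNReal.tsum_le_tsum fun j => ?_
  rw [← tsum_geomWeight_sub (δ / 2) k, ← ENNReal.tsum_mul_right]
  refine ENNReal.tsum_le_tsum fun m => ?_
  have e : geomWeight δ (m - k) = geomWeight (δ / 2) (m - k) * geomWeight (δ / 2) (m - k) := by
    rw [geomWeight_mul]; ring_nf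
  have h := geomWeight_mul_le (by linarith : 0 ≤ δ / 2) (m - k) (j - m)
  have e2 : m - k + (j - m) = j - k := by ring
  rw [e2] at h
  calc geomWeight δ (m - k) * (geomWeight δ (j - m) * a j)
      ≤ geomWeight δ (m - k) * (geomWeight (δ / 2) (j - m) * a j) := by
        gcongr; exact geomWeight_anti (by linarith) _
    _ = geomWeight (δ / 2) (m - k) *
          (geomWeight (δ / 2) (m - k) * geomWeight (δ / 2) (j - m) * a j) := by rw [e]; ring
    _ ≤ _ := by gcongr

lemma measure_ball_le_mul [PseudoMetricSpace X] [MeasurableSpace X] {μ : Measure X} {c Q : ℝ}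
    (hQ : 0 < Q) (hc : 0 < c) (hdim : DimLowerBound μ c Q) {x y : X} {r R K : ℝ}
    (hr : 0 < r) (hrR : r ≤ R) (hK : R ≤ K * r) (hy : y ∈ ball x R) :
    μ (ball x R) ≤ ENNReal.ofReal (K ^ Q / c) * μ (ball y r) := by
  have hR : 0 < R := hr.trans_le hrR
  have hK0 : 0 < K := by
    by_contra h
    have := mul_nonpos_of_nonpos_of_nonneg (not_lt.1 h) hr.le
    linarith
  have h1 := hdim x y r R hr hrR hy
  have h2 : 1 ≤ K ^ Q / c * (c * (r / R) ^ Q) := by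
    have : K ^ Q / c * (c * (r / R) ^ Q) = (K * (r / R)) ^ Q := by
      rw [Real.mul_rpow hK0.le (by positivity)]; field_simp
    rw [this]
    refine Real.one_le_rpow ?_ hQ.le
    rw [← mul_div_assoc, le_div_iff₀ hR]; linarith
  calc μ (ball x R) = ENNReal.ofReal 1 * μ (ball x R) := by simp
    _ ≤ ENNReal.ofReal (K ^ Q / c * (c * (r / R) ^ Q)) * μ (ball x R) := by gcongr
    _ = ENNReal.ofReal (K ^ Q / c) * (ENNReal.ofReal (c * (r / R) ^ Q) * μ (ball x R)) := by
      rw [ENNReal.ofReal_mul (by positivity), mul_assoc]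
    _ ≤ _ := by gcongr

lemma setLAverage_ball_le_mul [PseudoMetricSpace X] [MeasurableSpace X] {μ : Measure X} {c Q : ℝ}
    (hQ : 0 < Q) (hc : 0 < c) (hdim : DimLowerBound μ c Q)
    (h0 : ∀ (x : X) (r : ℝ), 0 < r → μ (ball x r) ≠ 0) (htop : ∀ (x : X) (r : ℝ), μ (ball x r) ≠ ⊤)
    {x y : X} {r R K : ℝ} (hr : 0 < r) (hrR : r ≤ R) (hK : R ≤ K * r)
    (hsub : ball y r ⊆ ball x R) (f : X → ℝ≥0∞) :
    ⨍⁻ z in ball y r, f z ∂μ ≤ ENNReal.ofReal (K ^ Q / c) * ⨍⁻ z in ball x R, f z ∂μ := by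
  have h := measure_ball_le_mul hQ hc hdim hr hrR hK (hsub (mem_ball_self hr))
  rw [setLAverage_eq, setLAverage_eq, ENNReal.div_le_iff (h0 _ _ hr) (htop _ _)]
  have hI : ∫⁻ z in ball y r, f z ∂μ ≤ ∫⁻ z in ball x R, f z ∂μ := lintegral_mono_set hsub
  calc ∫⁻ z in ball y r, f z ∂μ ≤ ∫⁻ z in ball x R, f z ∂μ := hI
    _ = (∫⁻ z in ball x R, f z ∂μ) / μ (ball x R) * μ (ball x R) := by
      rw [ENNReal.div_mul_cancel (h0 _ _ (hr.trans_le hrR)) (htop _ _)]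
    _ ≤ (∫⁻ z in ball x R, f z ∂μ) / μ (ball x R) *
          (ENNReal.ofReal (K ^ Q / c) * μ (ball y r)) := by gcongr
    _ = _ := by ring

lemma setLAverage_rpow_le [MeasurableSpace X] {μ : Measure X} {τ : ℝ} (hτ : 1 ≤ τ) {s : Set X}
    (h0 : μ s ≠ 0) (htop : μ s ≠ ⊤)
    {f : X → ℝ≥0∞} (hf : Measurable f) :
    (⨍⁻ y in s, f y ∂μ) ^ τ ≤ ⨍⁻ y in s, f y ^ τ ∂μ := by
  have : IsProbabilityMeasure ((μ.restrict s Set.univ)⁻¹ • μ.restrict s) := by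
    constructor
    simp [ENNReal.inv_mul_cancel h0 htop]
  have h := eLpNorm'_le_eLpNorm'_of_exponent_le (μ := ((μ.restrict s Set.univ)⁻¹ • μ.restrict s))
    (f := f) (p := 1) (q := τ) one_pos hτ hf.aestronglyMeasurable
  simp only [eLpNorm', enorm_eq_self, ENNReal.rpow_one, div_one] at h
  rwa [one_div, ENNReal.le_rpow_inv_iff (by linarith)] at h

section Averaging

variable [PseudoMetricSpace X] [SecondCountableTopology X] [MeasurableSpace X] [BorelSpace X]
  {μ : Measure X} [SFinite μ]

lemma measurable_lintegral_ball (R : ℝ) {f : X → ℝ≥0∞} (hf : Measurable f) :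
    Measurable fun x => ∫⁻ y in ball x R, f y ∂μ := by
  have hm : MeasurableSet {z : X × X | dist z.2 z.1 < R} :=
    measurableSet_lt (measurable_snd.dist measurable_fst) measurable_const
  have h : Measurable fun z : X × X => {z : X × X | dist z.2 z.1 < R}.indicator
      (fun z => f z.2) z := (hf.comp measurable_snd).indicator hm
  convert h.lintegral_prod_right' (ν := μ) using 2 with x
  rw [← lintegral_indicator measurableSet_ball]
  rfl

lemma measurable_setLAverage_ball (R : ℝ) {f : X → ℝ≥0∞} (hf : Measurable f) :
    Measurable fun x => ⨍⁻ y in ball x R, f y ∂μ := by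
  simp_rw [setLAverage_eq]
  have h1 : Measurable fun x => μ (ball x R) := by
    simpa using measurable_lintegral_ball (μ := μ) R (measurable_const (a := (1 : ℝ≥0∞)))
  exact (measurable_lintegral_ball R hf).div h1

lemma lintegral_setLAverage_rpow_le {c Q τ : ℝ} (hQ : 0 < Q) (hc : 0 < c)
    (hdim : DimLowerBound μ c Q) (h0 : ∀ (x : X) (r : ℝ), 0 < r → μ (ball x r) ≠ 0)
    (htop : ∀ (x : X) (r : ℝ), μ (ball x r) ≠ ⊤) (hτ : 1 ≤ τ) {R : ℝ} (hR : 0 < R)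
    {f : X → ℝ≥0∞} (hf : Measurable f) :
    ∫⁻ x, (⨍⁻ y in ball x R, f y ∂μ) ^ τ ∂μ ≤
      ENNReal.ofReal (2 ^ Q / c) * ∫⁻ x, f x ^ τ ∂μ := by
  set K := ENNReal.ofReal (2 ^ Q / c)
  have hm : MeasurableSet {z : X × X | dist z.1 z.2 < R} :=
    measurableSet_lt (measurable_fst.dist measurable_snd) measurable_const
  have hμR : Measurable fun x => μ (ball x R) := by
    simpa using measurable_lintegral_ball (μ := μ) R (measurable_const (a := (1 : ℝ≥0∞)))
  set F : X → X → ℝ≥0∞ := fun x y => {z : X × X | dist z.1 z.2 < R}.indicator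
    (fun z => K * (f z.2 ^ τ * (μ (ball z.2 R))⁻¹)) (x, y) with hF
  have hFm : Measurable (Function.uncurry F) := by
    refine Measurable.indicator ?_ hm
    exact (((hf.comp measurable_snd).pow_const τ).mul (hμR.comp measurable_snd).inv).const_mul K
  have h1 : ∀ x, (⨍⁻ y in ball x R, f y ∂μ) ^ τ ≤ ∫⁻ y, F x y ∂μ := by
    intro x
    refine (setLAverage_rpow_le hτ (h0 x R hR) (htop x R) hf).trans ?_
    rw [setLAverage_eq, div_eq_mul_inv, ← lintegral_mul_const _ (hf.pow_const τ),
      ← lintegral_indicator measurableSet_ball]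
    refine lintegral_mono fun y => ?_
    by_cases hy : dist x y < R
    · have hy' : y ∈ ball x R := by rwa [mem_ball, dist_comm]
      have hb : μ (ball y R) ≤ K * μ (ball x R) := by
        refine (measure_mono (ball_subset_ball (by linarith : R ≤ 2 * R))).trans ?_
        exact measure_ball_le_mul hQ hc hdim hR (by linarith) le_rfl (by
          rw [mem_ball]; linarith)
      have hb2 : (μ (ball x R))⁻¹ ≤ K * (μ (ball y R))⁻¹ := by
        rw [← div_eq_mul_inv, ENNReal.le_div_iff_mul_le (Or.inl (h0 y R hR)) (Or.inl (htop y R)),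
          mul_comm, ← div_eq_mul_inv]
        exact ENNReal.div_le_of_le_mul hb
      simp only [hF, Set.indicator, Set.mem_ofPred_eq, hy, hy', if_true]
      calc f y ^ τ * (μ (ball x R))⁻¹ ≤ f y ^ τ * (K * (μ (ball y R))⁻¹) := by gcongr
        _ = _ := by ring
    · have hy' : y ∉ ball x R := by rwa [mem_ball, dist_comm]
      simp [Set.indicator_of_notMem hy']
  calc ∫⁻ x, (⨍⁻ y in ball x R, f y ∂μ) ^ τ ∂μ ≤ ∫⁻ x, ∫⁻ y, F x y ∂μ ∂μ := lintegral_mono h1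
    _ = ∫⁻ y, ∫⁻ x, F x y ∂μ ∂μ := lintegral_lintegral_swap hFm.aemeasurable
    _ = ∫⁻ y, K * f y ^ τ ∂μ := by
      refine lintegral_congr fun y => ?_
      have : ∀ x, F x y = (ball y R).indicator
          (fun _ => K * (f y ^ τ * (μ (ball y R))⁻¹)) x := by
        intro x
        simp only [hF, Set.indicator, Set.mem_ofPred_eq, mem_ball]
      simp_rw [this]
      rw [lintegral_indicator measurableSet_ball, setLIntegral_const, mul_assoc, mul_assoc,
        ENNReal.inv_mul_cancel (h0 y R hR) (htop y R), mul_one]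
    _ = K * ∫⁻ x, f x ^ τ ∂μ := lintegral_const_mul K (hf.pow_const τ)

end Averaging

section Poincare

variable [PseudoMetricSpace X] [MeasurableSpace X] [OpensMeasurableSpace X] {μ : Measure X}

/-- A function whose average over a ball is small must be small somewhere in every sub-ball that
is not too small. -/
lemma exists_mem_ball_le_of_setLAverage_le {c Q : ℝ} (hQ : 0 < Q) (hc : 0 < c)
    (hdim : DimLowerBound μ c Q) (h0 : ∀ (x : X) (r : ℝ), 0 < r → μ (ball x r) ≠ 0)
    (htop : ∀ (x : X) (r : ℝ), μ (ball x r) ≠ ⊤) {x z : X} {r R a M : ℝ} (hr : 0 < r)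
    (hrR : r ≤ R) (hsub : ball z r ⊆ ball x R) (ha : 0 < a) {T : X → ℝ≥0∞} {E : Set X}
    (hE : μ E = 0) (hT : ⨍⁻ y in ball x R, T y ∂μ ≤ ENNReal.ofReal a)
    (hM : (R / r) ^ Q / c * a < M) :
    ∃ y ∈ ball z r, y ∉ E ∧ T y ≤ ENNReal.ofReal M := by
  by_contra! hcon
  have hR : 0 < R := hr.trans_le hrR
  have hae : ∀ᵐ y ∂μ, y ∈ ball z r → ENNReal.ofReal M ≤ T y := by
    have : ∀ᵐ y ∂μ, y ∉ E := measure_eq_zero_iff_ae_notMem.1 hE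
    filter_upwards [this] with y hy hyb using (hcon y hyb hy).le
  have h1 : ENNReal.ofReal M * μ (ball z r) ≤ ∫⁻ y in ball x R, T y ∂μ := by
    calc ENNReal.ofReal M * μ (ball z r) = ∫⁻ _ in ball z r, ENNReal.ofReal M ∂μ := by simp
      _ ≤ ∫⁻ y in ball z r, T y ∂μ := setLIntegral_mono_ae' measurableSet_ball hae
      _ ≤ _ := lintegral_mono_set hsub
  rw [setLAverage_eq, ENNReal.div_le_iff (h0 _ _ hR) (htop _ _)] at hT
  have h2 := measure_ball_le_mul hQ hc hdim hr hrR (K := R / r) (by field_simp; rfl)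
    (hsub (mem_ball_self hr))
  have h3 : ENNReal.ofReal M * μ (ball z r) ≤
      ENNReal.ofReal ((R / r) ^ Q / c * a) * μ (ball z r) := by
    calc _ ≤ ENNReal.ofReal a * μ (ball x R) := h1.trans hT
      _ ≤ ENNReal.ofReal a * (ENNReal.ofReal ((R / r) ^ Q / c) * μ (ball z r)) := by gcongr
      _ = _ := by rw [ENNReal.ofReal_mul (by positivity)]; ring
  rw [ENNReal.mul_le_mul_iff_left (h0 _ _ hr) (htop _ _)] at h3
  have h4 : 0 ≤ (R / r) ^ Q / c * a := by positivity
  rw [ENNReal.ofReal_le_ofReal_iff h4] at h3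
  linarith

/-- Chaining through sublevel sets of `T`: a point of the `n`-th sublevel set is connected to
the lowest sublevel set with an increment of size `2 ^ n`. -/
lemma exists_chain_to_lowest_level {c Q σ : ℝ} (hQ : 0 < Q) (hc : 0 < c) (hσ : 0 < σ)
    (hdim : DimLowerBound μ c Q) (h0 : ∀ (x : X) (r : ℝ), 0 < r → μ (ball x r) ≠ 0)
    (htop : ∀ (x : X) (r : ℝ), μ (ball x r) ≠ ⊤) {x : X} {R a A κ θ : ℝ} (hR : 0 < R)
    (ha : 0 < a) (hA : 0 ≤ A) (hθ : θ = 2 ^ (-(1 / Q)))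
    (hκ : κ = 2 * ((2 / (1 - θ)) ^ Q / c)) {T : X → ℝ≥0∞} {E : Set X} {v : X → ℝ}
    (hE : μ E = 0) (hT : ⨍⁻ y in ball x (2 * R), T y ∂μ ≤ ENNReal.ofReal a)
    (hv : ∀ z ∈ ball x (2 * R), z ∉ E → ∀ w ∈ ball x (2 * R), w ∉ E → ∀ M : ℝ, 0 ≤ M →
      T z ≤ ENNReal.ofReal M → T w ≤ ENNReal.ofReal M →
        |v z - v w| ≤ dist z w ^ σ * (A * M ^ (1 + σ / Q))) (n : ℕ) :
    ∀ z ∉ E, T z ≤ ENNReal.ofReal (κ * a * 2 ^ n) → dist z x < R + R * θ ^ n →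
      ∃ w ∈ ball x (2 * R), w ∉ E ∧ T w ≤ ENNReal.ofReal (κ * a) ∧
        |v z - v w| ≤ A * (2 * κ * a) ^ (1 + σ / Q) * R ^ σ * (2 ^ n - 1) := by
  have hθ0 : 0 < θ := by rw [hθ]; positivity
  have hθ1 : θ < 1 := by
    rw [hθ]
    exact Real.rpow_lt_one_of_one_lt_of_neg (by norm_num) (by simpa using hQ)
  have h1θ : 0 < 1 - θ := by linarith
  have hκ0 : 0 < κ := by rw [hκ]; positivity
  have hθQ : ∀ n : ℕ, (θ ^ n) ^ Q = ((2 : ℝ) ^ n)⁻¹ := by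
    intro n
    rw [hθ, ← Real.rpow_natCast, ← Real.rpow_mul (by positivity), ← Real.rpow_mul (by norm_num),
      ← Real.rpow_natCast, ← Real.rpow_neg (by norm_num)]
    congr 1
    field_simp
  induction n with
  | zero =>
    intro z hz hTz hd
    refine ⟨z, ?_, hz, by simpa using hTz, by simp⟩
    rw [mem_ball]; simp at hd; linarith
  | succ n ih =>
    intro z hz hTz hd
    set r := (1 - θ) * θ ^ n * R with hr
    have hθn : 0 < θ ^ n := by positivity
    have hθn1 : θ ^ n ≤ 1 := pow_le_one₀ hθ0.le hθ1.le
    have hr0 : 0 < r := by positivity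
    have hrR : r ≤ R := by
      have : (1 - θ) * θ ^ n ≤ 1 * 1 := by gcongr; linarith
      calc r ≤ 1 * 1 * R := by rw [hr]; gcongr
        _ = R := by ring
    have hdr : dist z x + r < R + R * θ ^ n := by
      rw [hr]; rw [pow_succ] at hd; nlinarith
    have hRθ : R * θ ^ n ≤ R := by nlinarith
    have hsub : ball z r ⊆ ball x (2 * R) := ball_subset_ball' (by linarith)
    obtain ⟨y, hyb, hyE, hTy⟩ := exists_mem_ball_le_of_setLAverage_le hQ hc hdim h0 htop hr0
      (by linarith) hsub ha hE hT (M := κ * a * 2 ^ n) (by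
        have e : (2 * R / r) ^ Q = (2 / (1 - θ)) ^ Q * 2 ^ n := by
          have : 2 * R / r = 2 / (1 - θ) * (θ ^ n)⁻¹ := by rw [hr]; field_simp
          rw [this, Real.mul_rpow (by positivity) (by positivity), Real.inv_rpow hθn.le, hθQ,
            inv_inv]
        rw [e, hκ]
        have : 0 < (2 / (1 - θ)) ^ Q / c * a * 2 ^ n := by positivity
        calc (2 / (1 - θ)) ^ Q * 2 ^ n / c * a = (2 / (1 - θ)) ^ Q / c * a * 2 ^ n := by ring
          _ < 2 * ((2 / (1 - θ)) ^ Q / c * a * 2 ^ n) := by linarith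
          _ = _ := by ring)
    have hyd : dist y x < R + R * θ ^ n := by
      have := dist_triangle y z x
      rw [mem_ball] at hyb
      linarith
    obtain ⟨w, hw, hwE, hTw, hvw⟩ := ih y hyE hTy hyd
    refine ⟨w, hw, hwE, hTw, ?_⟩
    have hzx : z ∈ ball x (2 * R) := hsub (mem_ball_self hr0)
    have hstep := hv z hzx hz y (hsub hyb) hyE (κ * a * 2 ^ (n + 1)) (by positivity) hTz
      (hTy.trans (ENNReal.ofReal_le_ofReal (by gcongr <;> norm_num)))
    have hd1 : dist z y ^ σ ≤ (θ ^ n) ^ σ * R ^ σ := by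
      rw [← Real.mul_rpow hθn.le hR.le]
      refine Real.rpow_le_rpow dist_nonneg ?_ hσ.le
      rw [mem_ball'] at hyb
      refine hyb.le.trans ?_
      rw [hr, mul_assoc]
      exact mul_le_of_le_one_left (by positivity) (by linarith)
    have hpow : (θ ^ n) ^ σ * (κ * a * 2 ^ (n + 1)) ^ (1 + σ / Q) =
        (2 * κ * a) ^ (1 + σ / Q) * 2 ^ n := by
      have e1 : κ * a * 2 ^ (n + 1) = 2 * κ * a * 2 ^ n := by ring
      have e2 : (θ ^ n) ^ σ = (((2 : ℝ) ^ n) ^ (σ / Q))⁻¹ := by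
        rw [← Real.inv_rpow (by positivity), ← hθQ, ← Real.rpow_mul hθn.le]
        congr 1; field_simp
      rw [e1, e2, Real.mul_rpow (by positivity) (by positivity),
        Real.rpow_add (by positivity : (0 : ℝ) < 2 ^ n), Real.rpow_one]
      field_simp
    calc |v z - v w| ≤ |v z - v y| + |v y - v w| := abs_sub_le _ _ _
      _ ≤ (θ ^ n) ^ σ * R ^ σ * (A * (κ * a * 2 ^ (n + 1)) ^ (1 + σ / Q)) +
          A * (2 * κ * a) ^ (1 + σ / Q) * R ^ σ * (2 ^ n - 1) := by
        gcongr
        exact hstep.trans (by gcongr)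
      _ = A * R ^ σ * ((θ ^ n) ^ σ * (κ * a * 2 ^ (n + 1)) ^ (1 + σ / Q)) +
          A * (2 * κ * a) ^ (1 + σ / Q) * R ^ σ * (2 ^ n - 1) := by ring
      _ = _ := by rw [hpow]; ring

/-- Sobolev–Poincaré inequality: a function which is Hölder continuous along the sublevel sets
of `T`, with the constants growing as a power of the level, has oscillation controlled by the
average of `T`. -/
lemma exists_setLAverage_sub_const_le {c Q σ : ℝ} (hQ : 0 < Q) (hc : 0 < c) (hσ : 0 < σ)
    (hdim : DimLowerBound μ c Q) (h0 : ∀ (x : X) (r : ℝ), 0 < r → μ (ball x r) ≠ 0)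
    (htop : ∀ (x : X) (r : ℝ), μ (ball x r) ≠ ⊤) :
    ∃ C : ℝ, 0 < C ∧ ∀ (x : X) (R A : ℝ) (T : X → ℝ≥0∞) (E : Set X) (v : X → ℝ),
      0 < R → 0 < A → Measurable T → μ E = 0 → ⨍⁻ y in ball x (2 * R), T y ∂μ ≠ ⊤ →
      (∀ z ∈ ball x (2 * R), z ∉ E → ∀ w ∈ ball x (2 * R), w ∉ E → ∀ M : ℝ, 0 ≤ M →
        T z ≤ ENNReal.ofReal M → T w ≤ ENNReal.ofReal M →
          |v z - v w| ≤ dist z w ^ σ * (A * M ^ (1 + σ / Q))) →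
      ∃ b : ℝ, ⨍⁻ y in ball x R, ‖v y - b‖ₑ ∂μ ≤
        ENNReal.ofReal (C * A * R ^ σ) * (⨍⁻ y in ball x (2 * R), T y ∂μ) ^ (1 + σ / Q) := by
  obtain ⟨θ, hθ⟩ : ∃ θ : ℝ, θ = 2 ^ (-(1 / Q)) := ⟨_, rfl⟩
  obtain ⟨κ, hκ⟩ : ∃ κ : ℝ, κ = 2 * ((2 / (1 - θ)) ^ Q / c) := ⟨_, rfl⟩
  have hθ0 : 0 < θ := by rw [hθ]; positivity
  have hθ1 : θ < 1 := by
    rw [hθ]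
    exact Real.rpow_lt_one_of_one_lt_of_neg (by norm_num) (by simpa using hQ)
  have h1θ : 0 < 1 - θ := by linarith
  have hκ0 : 0 < κ := by rw [hκ]; positivity
  refine ⟨(2 * κ) ^ (1 + σ / Q) * 4 ^ σ * (1 + 2 / κ * (2 ^ Q / c)), by positivity, ?_⟩
  intro x R A T E v hR hA hTm hE hTtop hv
  have hEae : ∀ᵐ y ∂μ, y ∉ E := measure_eq_zero_iff_ae_notMem.1 hE
  rcases eq_or_ne (⨍⁻ y in ball x (2 * R), T y ∂μ) 0 with hz | hnz
  · have hz' : ∀ᵐ y ∂μ.restrict (ball x (2 * R)), T y = 0 := by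
      rw [setLAverage_eq, ENNReal.div_eq_zero_iff] at hz
      have := hz.resolve_right (htop _ _)
      rwa [lintegral_eq_zero_iff hTm] at this
    have hz2 : ∀ᵐ y ∂μ.restrict (ball x R), y ∈ ball x R ∧ y ∉ E ∧ T y = 0 := by
      filter_upwards [ae_restrict_mem measurableSet_ball, ae_restrict_of_ae hEae,
        ae_restrict_of_ae_restrict_of_subset (ball_subset_ball (by linarith : R ≤ 2 * R)) hz']
        with y h1 h2 h3 using ⟨h1, h2, h3⟩
    have : (ae (μ.restrict (ball x R))).NeBot := by
      rw [ae_neBot, Ne, Measure.restrict_eq_zero]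
      exact h0 x R hR
    obtain ⟨b, hb, hbE, hTb⟩ := hz2.exists
    refine ⟨v b, le_of_eq_of_le ?_ zero_le⟩
    have hsub : ball x R ⊆ ball x (2 * R) := ball_subset_ball (by linarith)
    rw [setLAverage_eq, ENNReal.div_eq_zero_iff]
    left
    refine lintegral_eq_zero_of_ae_eq_zero ?_
    filter_upwards [hz2] with y ⟨hy, hyE, hTy⟩
    have := hv y (hsub hy) hyE b (hsub hb) hbE 0 le_rfl (by simp [hTy]) (by simp [hTb])
    rw [Real.zero_rpow (by positivity), mul_zero, mul_zero] at this
    have h' : v y - v b = 0 := abs_eq_zero.1 (le_antisymm this (abs_nonneg _))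
    simp [h']
  · obtain ⟨a, ha⟩ : ∃ a : ℝ, a = (⨍⁻ y in ball x (2 * R), T y ∂μ).toReal := ⟨_, rfl⟩
    have ha0 : 0 < a := by rw [ha]; exact ENNReal.toReal_pos hnz hTtop
    have haT : ⨍⁻ y in ball x (2 * R), T y ∂μ = ENNReal.ofReal a := by
      rw [ha, ENNReal.ofReal_toReal hTtop]
    have hchain := exists_chain_to_lowest_level hQ hc hσ hdim h0 htop hR ha0 hA.le hθ hκ hE
      haT.le hv
    set K := A * (2 * κ * a) ^ (1 + σ / Q) * R ^ σ with hK
    have hK0 : 0 < K := by positivity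
    obtain ⟨b₀, hb₀, hb₀E, hTb₀⟩ := exists_mem_ball_le_of_setLAverage_le hQ hc hdim h0 htop
      (z := x) (r := (1 - θ) * R) (M := κ * a) (by positivity) (by nlinarith)
      (ball_subset_ball (by nlinarith)) ha0 hE haT.le (by
        have e : 2 * R / ((1 - θ) * R) = 2 / (1 - θ) := by field_simp
        rw [e, hκ]
        have : 0 < (2 / (1 - θ)) ^ Q / c * a := by positivity
        linarith)
    have hb₀2 : b₀ ∈ ball x (2 * R) := ball_subset_ball (by nlinarith) hb₀
    have hpt : ∀ z ∈ ball x R, z ∉ E →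
        ‖v z - v b₀‖ₑ ≤ ENNReal.ofReal (K * 4 ^ σ) * (1 + ENNReal.ofReal (2 / (κ * a)) * T z) := by
      intro z hz hzE
      rcases eq_or_ne (T z) ⊤ with hTz | hTz
      · rw [hTz, ENNReal.mul_top (by simpa using by positivity), add_top, ENNReal.mul_top]
        · exact le_top
        · simpa using by positivity
      obtain ⟨τ, hτ0, hτ⟩ : ∃ τ : ℝ, 0 ≤ τ ∧ T z = ENNReal.ofReal τ :=
        ⟨(T z).toReal, ENNReal.toReal_nonneg, (ENNReal.ofReal_toReal hTz).symm⟩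
      obtain ⟨n, hn1, hn2⟩ : ∃ n : ℕ, τ ≤ κ * a * 2 ^ n ∧ (2 : ℝ) ^ n - 1 ≤ 2 / (κ * a) * τ := by
        by_cases h : τ ≤ κ * a
        · exact ⟨0, by simpa using h, by simp; positivity⟩
        · obtain ⟨n, h1, h2⟩ := exists_nat_pow_near (x := τ / (κ * a)) (y := (2 : ℝ))
            (by rw [le_div_iff₀ (by positivity)]; linarith) (by norm_num)
          refine ⟨n + 1, ?_, ?_⟩
          · rw [div_lt_iff₀ (by positivity)] at h2; linarith
          · calc (2 : ℝ) ^ (n + 1) - 1 ≤ 2 * 2 ^ n := by rw [pow_succ]; linarith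
              _ ≤ 2 * (τ / (κ * a)) := by gcongr
              _ = _ := by ring
      obtain ⟨w, hw, hwE, hTw, hvw⟩ := hchain n z hzE (by rw [hτ]; gcongr)
        (by rw [mem_ball] at hz; have : 0 < R * θ ^ n := by positivity
            linarith)
      have hlow := hv w hw hwE b₀ hb₀2 hb₀E (κ * a) (by positivity) hTw hTb₀
      have hd : dist w b₀ ^ σ ≤ 4 ^ σ * R ^ σ := by
        rw [← Real.mul_rpow (by norm_num) hR.le]
        refine Real.rpow_le_rpow dist_nonneg ?_ hσ.le
        have := dist_triangle_right w b₀ x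
        rw [mem_ball] at hw hb₀2
        linarith
      have hlow2 : |v w - v b₀| ≤ K * 4 ^ σ := by
        calc |v w - v b₀| ≤ 4 ^ σ * R ^ σ * (A * (2 * κ * a) ^ (1 + σ / Q)) := by
              refine hlow.trans ?_
              gcongr
              nlinarith
          _ = _ := by rw [hK]; ring
      have h4 : (1 : ℝ) ≤ 4 ^ σ := Real.one_le_rpow (by norm_num) hσ.le
      have hreal : |v z - v b₀| ≤ K * 4 ^ σ * (1 + 2 / (κ * a) * τ) := by
        calc |v z - v b₀| ≤ |v z - v w| + |v w - v b₀| := abs_sub_le _ _ _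
          _ ≤ K * (2 / (κ * a) * τ) + K * 4 ^ σ := by gcongr; exact hvw.trans (by gcongr)
          _ ≤ K * 4 ^ σ * (2 / (κ * a) * τ) + K * 4 ^ σ := by
            gcongr
            exact le_mul_of_one_le_right hK0.le h4
          _ = _ := by ring
      rw [hτ, ← ENNReal.ofReal_mul (by positivity), ← ENNReal.ofReal_one,
        ← ENNReal.ofReal_add (by positivity) (by positivity), ← ENNReal.ofReal_mul (by positivity),
        Real.enorm_eq_ofReal_abs]
      exact ENNReal.ofReal_le_ofReal hreal
    refine ⟨v b₀, ?_⟩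
    have hsub : ball x R ⊆ ball x (2 * R) := ball_subset_ball (by linarith)
    have havT : ⨍⁻ y in ball x R, T y ∂μ ≤ ENNReal.ofReal (2 ^ Q / c * a) := by
      have := setLAverage_ball_le_mul hQ hc hdim h0 htop hR (by linarith) le_rfl hsub T
      rwa [haT, ← ENNReal.ofReal_mul (by positivity)] at this
    calc ⨍⁻ y in ball x R, ‖v y - v b₀‖ₑ ∂μ
        ≤ ⨍⁻ y in ball x R, ENNReal.ofReal (K * 4 ^ σ) *
            (1 + ENNReal.ofReal (2 / (κ * a)) * T y) ∂μ := by
          rw [setLAverage_eq, setLAverage_eq]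
          gcongr 1
          refine setLIntegral_mono_ae' measurableSet_ball ?_
          filter_upwards [hEae] with y hyE hy using hpt y hy hyE
      _ = ENNReal.ofReal (K * 4 ^ σ) *
            (1 + ENNReal.ofReal (2 / (κ * a)) * ⨍⁻ y in ball x R, T y ∂μ) := by
          rw [setLAverage_eq, setLAverage_eq, lintegral_const_mul _ (by fun_prop),
            lintegral_add_left measurable_const, lintegral_const_mul _ hTm]
          simp only [lintegral_const, Measure.restrict_apply_univ, one_mul, div_eq_mul_inv]
          rw [mul_assoc, add_mul, ENNReal.mul_inv_cancel (h0 _ _ hR) (htop _ _)]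
          ring
      _ ≤ ENNReal.ofReal (K * 4 ^ σ) *
            (1 + ENNReal.ofReal (2 / (κ * a)) * ENNReal.ofReal (2 ^ Q / c * a)) := by gcongr
      _ = _ := by
          rw [haT, ENNReal.ofReal_rpow_of_pos ha0, ← ENNReal.ofReal_mul (by positivity),
            ← ENNReal.ofReal_one, ← ENNReal.ofReal_add (by positivity) (by positivity),
            ← ENNReal.ofReal_mul (by positivity), ← ENNReal.ofReal_mul (by positivity)]
          congr 1
          rw [hK, Real.mul_rpow (by positivity) ha0.le]
          field_simp

end Poincare

/-- The weighted sum `∑_j 2^{-δ|j-m|} g_j^t`. -/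
noncomputable def gradSum (δ t : ℝ) (g : ℤ → X → ℝ) (m : ℤ) (x : X) : ℝ≥0∞ :=
  ∑' j : ℤ, geomWeight δ (j - m) * ENNReal.ofReal (g j x) ^ t

/-- The `t`-average of the weighted gradients over a ball of radius `2^{1-m}`. -/
noncomputable def gradAverage [PseudoMetricSpace X] [MeasurableSpace X] (μ : Measure X)
    (δ t : ℝ) (g : ℤ → X → ℝ) (m : ℤ) (x : X) : ℝ≥0∞ :=
  (⨍⁻ y in ball x (2 * (2 : ℝ) ^ (-m)), gradSum δ t g m y ∂μ) ^ t⁻¹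

lemma measurable_gradSum [MeasurableSpace X] (δ t : ℝ) {g : ℤ → X → ℝ}
    (hg : ∀ k, Measurable (g k)) (m : ℤ) : Measurable (gradSum δ t g m) :=
  Measurable.tsum fun j => ((hg j).ennreal_ofReal.pow_const t).const_mul _

lemma measurable_gradAverage [PseudoMetricSpace X] [SecondCountableTopology X] [MeasurableSpace X]
    [BorelSpace X] {μ : Measure X} [SFinite μ] (δ t : ℝ) {g : ℤ → X → ℝ}
    (hg : ∀ k, Measurable (g k)) (m : ℤ) : Measurable (gradAverage μ δ t g m) :=
  (measurable_setLAverage_ball _ (measurable_gradSum δ t hg m)).pow_const _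

lemma exists_lintegral_gradAverage_rpow_le [PseudoMetricSpace X] [SecondCountableTopology X]
    [MeasurableSpace X] [BorelSpace X] {μ : Measure X} [SFinite μ] {c Q δ t p : ℝ}
    (hQ : 0 < Q) (hc : 0 < c) (hdim : DimLowerBound μ c Q)
    (h0 : ∀ (x : X) (r : ℝ), 0 < r → μ (ball x r) ≠ 0)
    (htop : ∀ (x : X) (r : ℝ), μ (ball x r) ≠ ⊤) (hδ : 0 < δ) (ht : 0 < t) (htp : t ≤ p) :
    ∃ C : ℝ≥0∞, C ≠ ⊤ ∧ ∃ δ' : ℝ, 0 < δ' ∧ ∀ g : ℤ → X → ℝ, (∀ k, Measurable (g k)) → ∀ m : ℤ,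
      ∫⁻ x, gradAverage μ δ t g m x ^ p ∂μ ≤
        C * ∑' j, geomWeight δ' (j - m) * ∫⁻ x, ENNReal.ofReal (g j x) ^ p ∂μ := by
  have hp : 0 < p := ht.trans_le htp
  obtain ⟨C, hC, hsum⟩ := exists_tsum_geomWeight_rpow_le hδ (div_pos hp ht)
  refine ⟨ENNReal.ofReal (2 ^ Q / c) * C, ENNReal.mul_ne_top ENNReal.ofReal_ne_top hC,
    δ / 2 * (p / t), by positivity, fun g hg m => ?_⟩
  have hpow : ∀ j x, (ENNReal.ofReal (g j x) ^ t) ^ (p / t) = ENNReal.ofReal (g j x) ^ p := by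
    intro j x
    rw [← ENNReal.rpow_mul, mul_div_cancel₀ _ ht.ne']
  calc ∫⁻ x, gradAverage μ δ t g m x ^ p ∂μ
      = ∫⁻ x, (⨍⁻ y in ball x (2 * (2 : ℝ) ^ (-m)), gradSum δ t g m y ∂μ) ^ (p / t) ∂μ := by
        refine lintegral_congr fun x => ?_
        rw [gradAverage, ← ENNReal.rpow_mul, div_eq_inv_mul]
    _ ≤ ENNReal.ofReal (2 ^ Q / c) * ∫⁻ x, gradSum δ t g m x ^ (p / t) ∂μ :=
        lintegral_setLAverage_rpow_le hQ hc hdim h0 htop ((one_le_div ht).2 htp) (by positivity)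
          (measurable_gradSum δ t hg m)
    _ ≤ ENNReal.ofReal (2 ^ Q / c) * ∫⁻ x, C * ∑' j, geomWeight (δ / 2 * (p / t)) (j - m) *
          ENNReal.ofReal (g j x) ^ p ∂μ := by
        gcongr with x
        simpa only [gradSum, hpow] using hsum (fun j => ENNReal.ofReal (g j x) ^ t) m
    _ = _ := by
        have hm : ∀ j, Measurable fun x => ENNReal.ofReal (g j x) ^ p :=
          fun j => (hg j).ennreal_ofReal.pow_const p
        rw [lintegral_const_mul _ (Measurable.tsum fun j => (hm j).const_mul _),
          lintegral_tsum fun j => ((hm j).const_mul _).aemeasurable, mul_assoc]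
        simp_rw [lintegral_const_mul _ (hm _)]

/-- Along the sublevel sets of `gradSum`, a function with fractional gradient `g` is Hölder
continuous. -/
lemma IsFracHajlaszGradient.abs_sub_le_of_gradSum_le [MetricSpace X] {s σ t : ℝ} (hσs : σ ≤ s)
    (hσ : 0 < σ) (ht : 0 < t) {u : X → ℝ} {g : ℤ → X → ℝ} (hg : ∀ k x, 0 ≤ g k x) {E : Set X}
    (hE : ∀ (k : ℤ), ∀ x ∉ E, ∀ y ∉ E,
      (2 : ℝ) ^ (-k - 1) ≤ dist x y → dist x y < (2 : ℝ) ^ (-k) →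
        |u x - u y| ≤ dist x y ^ s * (g k x + g k y)) {m : ℤ} {z w : X} (hz : z ∉ E) (hw : w ∉ E)
    (hd : dist z w < 4 * (2 : ℝ) ^ (-m)) {M : ℝ} (hM : 0 ≤ M)
    (hTz : gradSum ((s - σ) * t) t g m z ≤ ENNReal.ofReal M)
    (hTw : gradSum ((s - σ) * t) t g m w ≤ ENNReal.ofReal M) :
    |u z - u w| ≤ dist z w ^ σ * (2 * (2 : ℝ) ^ ((s - σ) * (4 - m)) * M ^ t⁻¹) := by
  rcases eq_or_ne z w with rfl | hzw
  · simp [Real.zero_rpow hσ.ne']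
  have hd0 : 0 < dist z w := dist_pos.2 hzw
  obtain ⟨n, hn1, hn2⟩ := exists_mem_Ico_zpow hd0 (one_lt_two : (1 : ℝ) < 2)
  obtain ⟨j, rfl⟩ : ∃ j : ℤ, n = -j - 1 := ⟨-n - 1, by ring⟩
  rw [show -j - 1 + 1 = -j by ring] at hn2
  have hjm : m - 2 ≤ j := by
    have h1 : (2 : ℝ) ^ (-j - 1) < 2 ^ (2 - m) := by
      refine hn1.trans_lt (hd.trans_eq ?_)
      rw [sub_eq_add_neg 2 m, zpow_add₀ (by norm_num)]
      norm_num
    have := (zpow_lt_zpow_iff_right₀ (one_lt_two : (1 : ℝ) < 2)).1 h1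
    omega
  have hlev : ∀ y, gradSum ((s - σ) * t) t g m y ≤ ENNReal.ofReal M →
      g j y ≤ (2 : ℝ) ^ ((s - σ) * |((j - m : ℤ) : ℝ)|) * M ^ t⁻¹ := by
    intro y hy
    have h1 : geomWeight ((s - σ) * t) (j - m) * ENNReal.ofReal (g j y) ^ t ≤ ENNReal.ofReal M :=
      (ENNReal.le_tsum (f := fun j => geomWeight ((s - σ) * t) (j - m) *
        ENNReal.ofReal (g j y) ^ t) j).trans hy
    rw [geomWeight, ENNReal.ofReal_rpow_of_nonneg (hg j y) ht.le,
      ← ENNReal.ofReal_mul (by positivity), ENNReal.ofReal_le_ofReal_iff hM] at h1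
    have h2 := Real.rpow_le_rpow (mul_nonneg (by positivity) (Real.rpow_nonneg (hg j y) t)) h1
      (inv_nonneg.2 ht.le)
    rw [Real.mul_rpow (by positivity) (Real.rpow_nonneg (hg j y) t), ← Real.rpow_mul (hg j y),
      mul_inv_cancel₀ ht.ne', Real.rpow_one, ← Real.rpow_mul (by norm_num)] at h2
    have e : -((s - σ) * t * |((j - m : ℤ) : ℝ)|) * t⁻¹ = -((s - σ) * |((j - m : ℤ) : ℝ)|) := by
      field_simp
    rw [e, Real.rpow_neg (by norm_num), inv_mul_le_iff₀ (by positivity)] at h2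
    exact h2
  have hds : dist z w ^ s ≤ dist z w ^ σ * 2 ^ (-(j : ℝ) * (s - σ)) := by
    have e : s = σ + (s - σ) := by ring
    conv_lhs => rw [e]
    rw [Real.rpow_add hd0]
    gcongr
    rw [Real.rpow_mul (by norm_num)]
    refine Real.rpow_le_rpow hd0.le (hn2.le.trans_eq ?_) (by linarith)
    rw [← Real.rpow_intCast]; push_cast; rfl
  have hexp : (2 : ℝ) ^ (-(j : ℝ) * (s - σ)) * 2 ^ ((s - σ) * |((j - m : ℤ) : ℝ)|) ≤
      2 ^ ((s - σ) * (4 - m)) := by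
    rw [← Real.rpow_add (by norm_num)]
    refine Real.rpow_le_rpow_of_exponent_le (by norm_num) ?_
    have habs : |((j - m : ℤ) : ℝ)| ≤ j - m + 4 := by
      have : |j - m| ≤ j - m + 4 := by rw [abs_le]; constructor <;> omega
      exact_mod_cast this
    have := mul_le_mul_of_nonneg_left habs (by linarith : 0 ≤ s - σ)
    linarith
  have hMt : 0 ≤ M ^ t⁻¹ := Real.rpow_nonneg hM _
  calc |u z - u w| ≤ dist z w ^ s * (g j z + g j w) := hE j z hz w hw hn1 hn2
    _ ≤ (dist z w ^ σ * 2 ^ (-(j : ℝ) * (s - σ))) *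
        ((2 : ℝ) ^ ((s - σ) * |((j - m : ℤ) : ℝ)|) * M ^ t⁻¹ +
          (2 : ℝ) ^ ((s - σ) * |((j - m : ℤ) : ℝ)|) * M ^ t⁻¹) := by
        gcongr
        · exact add_nonneg (hg j z) (hg j w)
        · exact hlev z hTz
        · exact hlev w hTw
    _ = dist z w ^ σ * (2 * ((2 : ℝ) ^ (-(j : ℝ) * (s - σ)) *
          2 ^ ((s - σ) * |((j - m : ℤ) : ℝ)|)) * M ^ t⁻¹) := by ring
    _ ≤ _ := by gcongr

lemma exists_setLAverage_abs_sub_le [MetricSpace X] [MeasurableSpace X] [OpensMeasurableSpace X]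
    {μ : Measure X} {c Q s σ : ℝ} (hQ : 0 < Q) (hc : 0 < c) (hσ : 0 < σ) (hσs : σ ≤ s)
    (hdim : DimLowerBound μ c Q) (h0 : ∀ (x : X) (r : ℝ), 0 < r → μ (ball x r) ≠ 0)
    (htop : ∀ (x : X) (r : ℝ), μ (ball x r) ≠ ⊤) :
    ∃ C : ℝ, 0 < C ∧ ∀ (u : X → ℝ) (g : ℤ → X → ℝ), IsFracHajlaszGradient μ s u g →
      ∀ (x : X) (m : ℤ), ∃ b : ℝ, 0 ≤ b ∧
        ⨍⁻ y in ball x ((2 : ℝ) ^ (-m)), ‖|u y| - b‖ₑ ∂μ ≤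
          ENNReal.ofReal (C * (2 : ℝ) ^ (-(m * s))) *
            gradAverage μ ((s - σ) * (1 + σ / Q)⁻¹) (1 + σ / Q)⁻¹ g m x := by
  obtain ⟨C, hC, hP⟩ := exists_setLAverage_sub_const_le hQ hc hσ hdim h0 htop
  refine ⟨C * (2 * 2 ^ ((s - σ) * 4)), by positivity, fun u g hg x m => ?_⟩
  obtain ⟨hgm, hg0, E, hE0, hE⟩ := hg
  have he : 0 < 1 + σ / Q := by positivity
  set t := (1 + σ / Q)⁻¹ with ht
  have ht0 : 0 < t := by positivity
  have hti : t⁻¹ = 1 + σ / Q := by rw [ht, inv_inv]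
  by_cases hfin : ⨍⁻ y in ball x (2 * (2 : ℝ) ^ (-m)), gradSum ((s - σ) * t) t g m y ∂μ = ⊤
  · refine ⟨0, le_rfl, ?_⟩
    rw [gradAverage, hfin, ENNReal.top_rpow_of_pos (inv_pos.2 ht0), ENNReal.mul_top]
    · exact le_top
    · simpa using by positivity
  obtain ⟨b, hb⟩ := hP x ((2 : ℝ) ^ (-m)) (2 * (2 : ℝ) ^ ((s - σ) * (4 - m)))
    (gradSum ((s - σ) * t) t g m) E u (by positivity) (by positivity)
    (measurable_gradSum _ _ hgm m) hE0 hfin (by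
      intro z hz hzE w hw hwE M hM hTz hTw
      rw [← hti]
      refine IsFracHajlaszGradient.abs_sub_le_of_gradSum_le hσs hσ ht0 hg0 hE hzE hwE ?_ hM hTz hTw
      have := dist_triangle_right z w x
      rw [mem_ball] at hz hw
      linarith)
  refine ⟨|b|, abs_nonneg b, ?_⟩
  calc ⨍⁻ y in ball x ((2 : ℝ) ^ (-m)), ‖|u y| - |b|‖ₑ ∂μ
      ≤ ⨍⁻ y in ball x ((2 : ℝ) ^ (-m)), ‖u y - b‖ₑ ∂μ := by
        rw [setLAverage_eq, setLAverage_eq]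
        gcongr with y
        rw [Real.enorm_eq_ofReal_abs, Real.enorm_eq_ofReal_abs]
        exact ENNReal.ofReal_le_ofReal (abs_abs_sub_abs_le_abs_sub _ _)
    _ ≤ _ := hb
    _ = _ := by
        rw [gradAverage, hti]
        congr 2
        rw [← Real.rpow_intCast, ← Real.rpow_mul (by norm_num)]
        have e1 : (2 : ℝ) ^ ((s - σ) * (4 - m)) = 2 ^ ((s - σ) * 4) * 2 ^ (-(m * (s - σ))) := by
          rw [← Real.rpow_add (by norm_num)]; ring_nf
        have e2 : (2 : ℝ) ^ (-(m * s)) = 2 ^ (-(m * (s - σ))) * 2 ^ (((-m : ℤ) : ℝ) * σ) := by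
          rw [← Real.rpow_add (by norm_num)]; push_cast; ring_nf
        rw [e1, e2]; ring

/-- The discrete convolution of `|u|` at scale `3r`. -/
noncomputable def DiscreteMaxData.dConv [PseudoMetricSpace X] [MeasurableSpace X]
    (D : DiscreteMaxData X) (μ : Measure X) (u : X → ℝ) (r : ℚ) (x : X) : ℝ≥0∞ :=
  ∑' i : ℕ, ENNReal.ofReal (D.φ r i x) * ⨍⁻ y in ball (D.center r i) (3 * (r : ℝ)), ‖u y‖₊ ∂μ

lemma DiscreteMaxData.tsum_ofReal_φ [PseudoMetricSpace X] (D : DiscreteMaxData X) {r : ℚ}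
    (hr : 0 < r) (x : X) : ∑' i, ENNReal.ofReal (D.φ r i x) = 1 := by
  have hs : Summable fun i => D.φ r i x := by
    by_contra h
    have := D.φ_sum r hr x
    rw [tsum_eq_zero_of_not_summable h] at this
    norm_num at this
  rw [← ENNReal.ofReal_tsum_of_nonneg (fun i => D.φ_nonneg r i x) hs, D.φ_sum r hr x,
    ENNReal.ofReal_one]

lemma laverage_add_left [MeasurableSpace X] {μ : Measure X} {f : X → ℝ≥0∞}
    (hf : AEMeasurable f μ) (g : X → ℝ≥0∞) :
    ⨍⁻ x, (f x + g x) ∂μ = ⨍⁻ x, f x ∂μ + ⨍⁻ x, g x ∂μ :=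
  lintegral_add_left' (hf.smul_measure _) g

lemma exists_dyadic_level {r : ℝ} (hr : 0 < r) :
    ∃ l : ℤ, (2 : ℝ) ^ (-l - 1) ≤ r ∧ r < (2 : ℝ) ^ (-l) := by
  obtain ⟨n, hn⟩ := exists_mem_Ico_zpow hr one_lt_two
  exact ⟨-n - 1, by simpa using hn.1, by simpa [sub_eq_add_neg, add_comm] using hn.2⟩

section Oscillation

variable [PseudoMetricSpace X] [MeasurableSpace X] {μ : Measure X}
  {c Q : ℝ} {u : X → ℝ} {b β : X → ℤ → ℝ≥0∞}

lemma setLAverage_enorm_le_and_le (hQ : 0 < Q) (hc : 0 < c) (hdim : DimLowerBound μ c Q)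
    (h0 : ∀ (x : X) (r : ℝ), 0 < r → μ (ball x r) ≠ 0) (htop : ∀ (x : X) (r : ℝ), μ (ball x r) ≠ ⊤)
    (hu : AEStronglyMeasurable u μ) {x y : X} {r R a : ℝ} (ha : 0 ≤ a)
    (hr : 0 < r) (hrR : r ≤ R) (hK : R ≤ 16 * r) (hsub : ball y r ⊆ ball x R) :
    ⨍⁻ z in ball y r, ‖u z‖₊ ∂μ ≤ ENNReal.ofReal a +
        ENNReal.ofReal (16 ^ Q / c) * ⨍⁻ z in ball x R, ‖|u z| - a‖ₑ ∂μ ∧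
      ENNReal.ofReal a ≤ ⨍⁻ z in ball y r, ‖u z‖₊ ∂μ +
        ENNReal.ofReal (16 ^ Q / c) * ⨍⁻ z in ball x R, ‖|u z| - a‖ₑ ∂μ := by
  have h := setLAverage_ball_le_mul hQ hc hdim h0 htop hr hrR hK hsub (fun z => ‖|u z| - a‖ₑ)
  have hconst : ⨍⁻ _ in ball y r, ENNReal.ofReal a ∂μ = ENNReal.ofReal a := by
    rw [setLAverage_const (h0 y r hr) (htop y r)]
  have hum : AEMeasurable (fun z => (‖u z‖₊ : ℝ≥0∞)) (μ.restrict (ball y r)) := hu.restrict.enorm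
  constructor
  · refine le_trans ?_ (add_le_add_right h _)
    rw [← hconst, ← laverage_add_left aemeasurable_const]
    refine lintegral_mono fun z => ?_
    change ‖u z‖ₑ ≤ _
    rw [Real.enorm_eq_ofReal_abs, Real.enorm_eq_ofReal_abs, ← ENNReal.ofReal_add ha (abs_nonneg _)]
    refine ENNReal.ofReal_le_ofReal ?_
    linarith [le_abs_self (|u z| - a)]
  · refine le_trans ?_ (add_le_add_right h _)
    rw [← laverage_add_left hum]
    conv_lhs => rw [← hconst]
    refine lintegral_mono fun z => ?_
    change _ ≤ ‖u z‖ₑ + _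
    rw [Real.enorm_eq_ofReal_abs, Real.enorm_eq_ofReal_abs,
      ← ENNReal.ofReal_add (abs_nonneg _) (abs_nonneg _)]
    refine ENNReal.ofReal_le_ofReal ?_
    linarith [neg_abs_le (|u z| - a)]

/-- `b x m` approximates, up to the error `β x m`, the mean of `|u|` over every sub-ball of
`ball x (2 ^ (-m))` of comparable radius. -/
def IsOscBound (μ : Measure X) (u : X → ℝ) (b β : X → ℤ → ℝ≥0∞) : Prop :=
  ∀ x m, b x m ≠ ⊤ ∧ ∀ (y : X) (r : ℝ), 0 < r → r ≤ (2 : ℝ) ^ (-m) → (2 : ℝ) ^ (-m) ≤ 16 * r →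
    ball y r ⊆ ball x ((2 : ℝ) ^ (-m)) →
    ⨍⁻ z in ball y r, ‖u z‖₊ ∂μ ≤ b x m + β x m ∧ b x m ≤ ⨍⁻ z in ball y r, ‖u z‖₊ ∂μ + β x m

lemma isOscBound_of_setLAverage_le (hQ : 0 < Q) (hc : 0 < c) (hdim : DimLowerBound μ c Q)
    (h0 : ∀ (x : X) (r : ℝ), 0 < r → μ (ball x r) ≠ 0) (htop : ∀ (x : X) (r : ℝ), μ (ball x r) ≠ ⊤)
    (hu : AEStronglyMeasurable u μ) {a : X → ℤ → ℝ} {β : X → ℤ → ℝ≥0∞}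
    (ha : ∀ x m, 0 ≤ a x m)
    (hβ : ∀ x m, ⨍⁻ y in ball x ((2 : ℝ) ^ (-m)), ‖|u y| - a x m‖ₑ ∂μ ≤ β x m) :
    IsOscBound μ u (fun x m => ENNReal.ofReal (a x m))
      (fun x m => ENNReal.ofReal (16 ^ Q / c) * β x m) := by
  refine fun x m => ⟨ENNReal.ofReal_ne_top, fun y r hr hrR hK hsub => ?_⟩
  obtain ⟨h1, h2⟩ := setLAverage_enorm_le_and_le hQ hc hdim h0 htop hu (ha x m) hr hrR hK hsub
  have h3 := hβ x m
  exact ⟨h1.trans (by beta_reduce; gcongr), h2.trans (by beta_reduce; gcongr)⟩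

/-- The approximating constants of two balls with a large common sub-ball are comparable. -/
lemma IsOscBound.const_le_const (hb : IsOscBound μ u b β) {x y z : X} {r : ℝ} {m n : ℤ} (hr : 0 < r)
    (hrm : r ≤ (2 : ℝ) ^ (-m)) (hKm : (2 : ℝ) ^ (-m) ≤ 16 * r)
    (hsubm : ball z r ⊆ ball x ((2 : ℝ) ^ (-m)))
    (hrn : r ≤ (2 : ℝ) ^ (-n)) (hKn : (2 : ℝ) ^ (-n) ≤ 16 * r)
    (hsubn : ball z r ⊆ ball y ((2 : ℝ) ^ (-n))) :
    b x m ≤ b y n + (β x m + β y n) := by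
  have h1 := ((hb x m).2 z r hr hrm hKm hsubm).2
  have h2 := ((hb y n).2 z r hr hrn hKn hsubn).1
  calc b x m ≤ _ := h1
    _ ≤ (b y n + β y n) + β x m := by gcongr
    _ = _ := by ring

lemma IsOscBound.const_succ_le_and_le (hb : IsOscBound μ u b β) (x : X) (m : ℤ) :
    b x (m + 1) ≤ b x m + (β x m + β x (m + 1)) ∧
      b x m ≤ b x (m + 1) + (β x m + β x (m + 1)) := by
  have e : (2 : ℝ) ^ (-m) = 2 * 2 ^ (-(m + 1)) := by
    rw [← zpow_one_add₀ (by norm_num)]; congr 1; ring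
  have hpos : (0 : ℝ) < 2 ^ (-(m + 1)) := by positivity
  have hsub : ball x ((2 : ℝ) ^ (-(m + 1))) ⊆ ball x ((2 : ℝ) ^ (-m)) :=
    ball_subset_ball (by linarith)
  constructor
  · rw [add_comm (β x m)]
    exact hb.const_le_const hpos le_rfl (by linarith) subset_rfl
      (by linarith) (by linarith) hsub
  · exact hb.const_le_const hpos (by linarith) (by linarith) hsub
      le_rfl (by linarith) subset_rfl

/-- Telescoping of the approximating constants of concentric balls. -/
lemma IsOscBound.const_add_nat_le_and_le (hb : IsOscBound μ u b β) (x : X) (m : ℤ) (n : ℕ) :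
    b x (m + n) ≤ b x m + 2 * ∑' i : ℕ, β x (m + i) ∧
      b x m ≤ b x (m + n) + 2 * ∑' i : ℕ, β x (m + i) := by
  have hfin : ∀ n : ℕ,
      b x (m + n) ≤ b x m + ∑ i ∈ Finset.range n, (β x (m + i) + β x (m + (i + 1 : ℕ))) ∧
      b x m ≤ b x (m + n) + ∑ i ∈ Finset.range n, (β x (m + i) + β x (m + (i + 1 : ℕ))) := by
    intro n
    induction n with
    | zero => simp
    | succ n ih =>
      obtain ⟨h1, h2⟩ := hb.const_succ_le_and_le x (m + n)
      have e : m + ((n + 1 : ℕ) : ℤ) = m + n + 1 := by push_cast; ring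
      rw [Finset.sum_range_succ, e]
      constructor
      · calc _ ≤ _ := h1
          _ ≤ _ := add_le_add_left ih.1 _
          _ = _ := by rw [add_assoc]
      · calc _ ≤ _ := ih.2
          _ ≤ _ := add_le_add_left h2 _
          _ = _ := by rw [add_assoc, add_comm (β x (m + n) + _)]
  have hsum : ∑ i ∈ Finset.range n, (β x (m + i) + β x (m + (i + 1 : ℕ))) ≤
      2 * ∑' i : ℕ, β x (m + i) := by
    rw [Finset.sum_add_distrib, two_mul]
    refine add_le_add (ENNReal.sum_le_tsum _) ?_
    refine le_trans ?_ (ENNReal.sum_le_tsum (f := fun i : ℕ => β x (m + i)) (Finset.range (n + 1)))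
    rw [Finset.sum_range_succ']
    exact le_self_add
  exact ⟨(hfin n).1.trans (by gcongr), (hfin n).2.trans (by gcongr)⟩

lemma IsOscBound.setLAverage_le_and_le (hb : IsOscBound μ u b β) {w x z : X} {r : ℝ} {l : ℤ}
    (hl : (2 : ℝ) ^ (-l - 1) ≤ r) (hl' : r < (2 : ℝ) ^ (-l)) (hx : x ∈ ball w (6 * r))
    (hxz : dist x z ≤ r) :
    ⨍⁻ y in ball w (3 * r), ‖u y‖₊ ∂μ ≤ b z (l - 4) + β z (l - 4) ∧
      b z (l - 4) ≤ ⨍⁻ y in ball w (3 * r), ‖u y‖₊ ∂μ + β z (l - 4) := by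
  have e1 : (2 : ℝ) ^ (-(l - 4)) = 16 * 2 ^ (-l) := by
    rw [show -(l - 4) = 4 + -l by ring, zpow_add₀ (by norm_num)]; norm_num
  have e2 : (2 : ℝ) ^ (-l) = 2 * 2 ^ (-l - 1) := by
    rw [← zpow_one_add₀ (by norm_num)]; congr 1; ring
  have hpos : (0 : ℝ) < 2 ^ (-l - 1) := by positivity
  refine (hb z (l - 4)).2 w (3 * r) (by linarith) (by linarith) (by linarith)
    (ball_subset_ball' ?_)
  have := mem_ball'.1 hx
  linarith [dist_triangle w x z]

lemma IsOscBound.dConv_le_and_le (hb : IsOscBound μ u b β) (D : DiscreteMaxData X) {r : ℚ}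
    (hr : 0 < r) {l : ℤ} (hl : (2 : ℝ) ^ (-l - 1) ≤ r) (hl' : r < (2 : ℝ) ^ (-l)) (x : X) :
    D.dConv μ u r x ≤ b x (l - 4) + β x (l - 4) ∧
      b x (l - 4) ≤ D.dConv μ u r x + β x (l - 4) := by
  have hr' : (0 : ℝ) < r := by exact_mod_cast hr
  have key : ∀ i, ENNReal.ofReal (D.φ r i x) * ⨍⁻ y in ball (D.center r i) (3 * r), ‖u y‖₊ ∂μ ≤
        ENNReal.ofReal (D.φ r i x) * (b x (l - 4) + β x (l - 4)) ∧
      ENNReal.ofReal (D.φ r i x) * b x (l - 4) ≤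
        ENNReal.ofReal (D.φ r i x) * (⨍⁻ y in ball (D.center r i) (3 * r), ‖u y‖₊ ∂μ +
          β x (l - 4)) := by
    intro i
    by_cases hx : x ∈ ball (D.center r i) (6 * (r : ℝ))
    · obtain ⟨h1, h2⟩ := hb.setLAverage_le_and_le hl hl' hx (z := x) (by simpa using hr'.le)
      exact ⟨by gcongr, by gcongr⟩
    · simp [D.φ_supp r hr i x hx]
  have h1 := D.tsum_ofReal_φ hr x
  constructor
  · refine (ENNReal.tsum_le_tsum fun i => (key i).1).trans ?_
    rw [ENNReal.tsum_mul_right, h1, one_mul]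
  · have := ENNReal.tsum_le_tsum fun i => (key i).2
    simp_rw [mul_add] at this
    rwa [ENNReal.tsum_add, ENNReal.tsum_mul_right, ENNReal.tsum_mul_right, h1, one_mul,
      one_mul] at this

lemma IsOscBound.dConv_le_and_le_of_le (hb : IsOscBound μ u b β) (D : DiscreteMaxData X) {r : ℚ}
    (hr : 0 < r) {k : ℤ} (hk : r < (2 : ℝ) ^ (-k)) (x : X) :
    D.dConv μ u r x ≤ b x (k - 4) + 3 * ∑' i : ℕ, β x (k - 4 + i) ∧
      b x (k - 4) ≤ D.dConv μ u r x + 3 * ∑' i : ℕ, β x (k - 4 + i) := by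
  have hr' : (0 : ℝ) < r := by exact_mod_cast hr
  obtain ⟨l, hl, hl'⟩ := exists_dyadic_level hr'
  have hkl : k ≤ l := by
    have := (zpow_lt_zpow_iff_right₀ (one_lt_two (α := ℝ))).1 (hl.trans_lt hk)
    omega
  obtain ⟨n, rfl⟩ := Int.le.dest hkl
  obtain ⟨h1, h2⟩ := hb.dConv_le_and_le D hr hl hl' x
  obtain ⟨h3, h4⟩ := hb.const_add_nat_le_and_le x (k - 4) n
  have h5 : β x (k - 4 + n) ≤ ∑' i : ℕ, β x (k - 4 + i) :=
    ENNReal.le_tsum (f := fun i : ℕ => β x (k - 4 + i)) n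
  rw [show k + n - 4 = k - 4 + n by ring] at h1 h2
  set S := ∑' i : ℕ, β x (k - 4 + i)
  constructor
  · calc _ ≤ _ := h1
      _ ≤ (b x (k - 4) + 2 * S) + S := add_le_add h3 h5
      _ = _ := by ring
  · calc _ ≤ _ := h4
      _ ≤ (D.dConv μ u r x + S) + 2 * S := by gcongr; exact h2.trans (by gcongr)
      _ = _ := by ring

lemma IsOscBound.dConv_le_of_lt (hb : IsOscBound μ u b β) (D : DiscreteMaxData X) {r : ℚ}
    (hr : 0 < r) {k : ℤ} (hk : r < (2 : ℝ) ^ (-k)) {x y : X} (hxy : dist x y < (2 : ℝ) ^ (-k)) :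
    D.dConv μ u r x ≤ D.dConv μ u r y +
      4 * (∑' i : ℕ, β x (k - 4 + i) + ∑' i : ℕ, β y (k - 4 + i)) := by
  have h1 := (hb.dConv_le_and_le_of_le D hr hk x).1
  have h2 := (hb.dConv_le_and_le_of_le D hr hk y).2
  have e1 : (2 : ℝ) ^ (-(k - 4)) = 16 * 2 ^ (-k) := by
    rw [show -(k - 4) = 4 + -k by ring, zpow_add₀ (by norm_num)]; norm_num
  have hpos : (0 : ℝ) < 2 ^ (-k) := by positivity
  have h3 : b x (k - 4) ≤ b y (k - 4) + (β x (k - 4) + β y (k - 4)) := by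
    refine hb.const_le_const (z := x) (r := 8 * 2 ^ (-k)) (by positivity) ?_ ?_
      (ball_subset_ball ?_) ?_ ?_ (ball_subset_ball' ?_) <;> linarith
  have h4 : ∀ z, β z (k - 4) ≤ ∑' i : ℕ, β z (k - 4 + i) := fun z => by
    simpa using ENNReal.le_tsum (f := fun i : ℕ => β z (k - 4 + i)) 0
  have h4x := h4 x
  have h4y := h4 y
  set S := ∑' i : ℕ, β x (k - 4 + i)
  set T := ∑' i : ℕ, β y (k - 4 + i)
  calc _ ≤ _ := h1
    _ ≤ ((D.dConv μ u r y + 3 * T) + (S + T)) + 3 * S := by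
      gcongr; exact h3.trans (by gcongr)
    _ = _ := by ring

lemma mul_add_mul_le_of_le_add {φ ψ V b β : ℝ≥0∞} (h1 : V ≤ b + β) (h2 : b ≤ V + β) :
    φ * V + ψ * b ≤ ψ * V + φ * b + ((φ - ψ) + (ψ - φ)) * β := by
  rcases le_total φ ψ with h | h
  · rw [tsub_eq_zero_of_le h, zero_add]
    nth_rw 1 2 [← add_tsub_cancel_of_le h]
    calc φ * V + (φ + (ψ - φ)) * b ≤ φ * V + φ * b + (ψ - φ) * (V + β) := by
          rw [add_mul, ← add_assoc]; gcongr
      _ = _ := by ring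
  · rw [tsub_eq_zero_of_le h, add_zero]
    nth_rw 1 2 [← add_tsub_cancel_of_le h]
    calc (ψ + (φ - ψ)) * V + ψ * b ≤ ψ * V + (φ - ψ) * (b + β) + ψ * b := by
          rw [add_mul]; gcongr
      _ = _ := by ring

lemma IsOscBound.dConv_le_of_le (hb : IsOscBound μ u b β) (D : DiscreteMaxData X) {r : ℚ}
    (hr : 0 < r) {l : ℤ} (hl : (2 : ℝ) ^ (-l - 1) ≤ r) (hl' : r < (2 : ℝ) ^ (-l)) {x y : X}
    (hxy : dist x y ≤ r) :
    D.dConv μ u r x ≤ D.dConv μ u r y +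
      ENNReal.ofReal (D.L / r * dist x y) * (4 * D.N) * β x (l - 4) := by
  have hr' : (0 : ℝ) < r := by exact_mod_cast hr
  set e := ENNReal.ofReal (D.L / r * dist x y) with he
  set B := b x (l - 4)
  set I : X → ℕ → ℝ≥0∞ := fun z i =>
    (ball (D.center r i) (6 * (r : ℝ))).indicator (fun _ => (1 : ℝ≥0∞)) z with hI
  have hdiff : ∀ i (z w : X), dist z w = dist x y →
      ENNReal.ofReal (D.φ r i z) - ENNReal.ofReal (D.φ r i w) ≤ e := by
    intro i z w hzw
    rw [← ENNReal.ofReal_sub _ (D.φ_nonneg r i w)]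
    refine ENNReal.ofReal_le_ofReal ?_
    have := (D.φ_lip r hr i).dist_le_mul z w
    rw [Real.coe_toNNReal _ (by have := D.L_pos; positivity), Real.dist_eq, hzw] at this
    exact (le_abs_self _).trans this
  have key : ∀ i, ENNReal.ofReal (D.φ r i x) * (⨍⁻ y in ball (D.center r i) (3 * r), ‖u y‖₊ ∂μ) +
        ENNReal.ofReal (D.φ r i y) * B ≤
      ENNReal.ofReal (D.φ r i y) * (⨍⁻ y in ball (D.center r i) (3 * r), ‖u y‖₊ ∂μ) +
        ENNReal.ofReal (D.φ r i x) * B + (I x i + I y i) * (2 * e * β x (l - 4)) := by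
    intro i
    by_cases h : x ∈ ball (D.center r i) (6 * (r : ℝ)) ∨ y ∈ ball (D.center r i) (6 * (r : ℝ))
    · obtain ⟨h1, h2⟩ : _ ∧ _ := by
        rcases h with h | h
        · exact hb.setLAverage_le_and_le hl hl' h (z := x) (by simpa using hr'.le)
        · exact hb.setLAverage_le_and_le hl hl' h (z := x) (by rwa [dist_comm])
      refine (mul_add_mul_le_of_le_add h1 h2).trans ?_
      have h3 : 1 ≤ I x i + I y i := by
        rcases h with h | h
        · simp [hI, Set.indicator_of_mem h]
        · simp [hI, Set.indicator_of_mem h]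
      have h4 := hdiff i x y rfl
      have h5 := hdiff i y x (dist_comm _ _)
      refine add_le_add_right ?_ _
      calc _ ≤ (e + e) * β x (l - 4) := by gcongr
        _ = 1 * (2 * e * β x (l - 4)) := by ring
        _ ≤ _ := by gcongr
    · push Not at h
      simp [D.φ_supp r hr i x h.1, D.φ_supp r hr i y h.2]
  have hsum := ENNReal.tsum_le_tsum key
  simp only [ENNReal.tsum_add, ENNReal.tsum_mul_right, D.tsum_ofReal_φ hr, one_mul] at hsum
  have hN : ∑' i, I x i + ∑' i, I y i ≤ 2 * D.N := by
    rw [two_mul]; exact add_le_add (D.overlap r hr x) (D.overlap r hr y)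
  refine ENNReal.le_of_add_le_add_right (hb x (l - 4)).1 (hsum.trans ?_)
  calc _ ≤ D.dConv μ u r y + B + (2 * D.N) * (2 * e * β x (l - 4)) := by
        gcongr; exact le_rfl
    _ = _ := by ring

end Oscillation

lemma ofReal_two_rpow_mul (a b : ℝ) :
    ENNReal.ofReal ((2 : ℝ) ^ a) * ENNReal.ofReal ((2 : ℝ) ^ b) =
      ENNReal.ofReal ((2 : ℝ) ^ (a + b)) := by
  rw [← ENNReal.ofReal_mul (by positivity), Real.rpow_add two_pos]

lemma two_zpow_neg_rpow (k : ℤ) (α : ℝ) : ((2 : ℝ) ^ (-k)) ^ α = 2 ^ (-(k * α)) := by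
  rw [← Real.rpow_intCast, ← Real.rpow_mul (by norm_num)]; push_cast; congr 1; ring

lemma tsum_nat_two_rpow_mul_le {s δ : ℝ} (hδ : 0 < δ) (hδs : δ ≤ s) (h : ℤ → ℝ≥0∞) (k : ℤ) :
    ∑' i : ℕ, ENNReal.ofReal (2 ^ (-((k - 4 + i : ℤ) * s))) * h (k - 4 + i) ≤
      ENNReal.ofReal (2 ^ (8 * s)) * ENNReal.ofReal (2 ^ (-(k * s))) *
        ∑' m, geomWeight δ (m - k) * h m := by
  have hinj : Function.Injective fun i : ℕ => k - 4 + (i : ℤ) := fun i j hij => by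
    simpa using hij
  rw [← ENNReal.tsum_mul_left]
  refine le_trans (ENNReal.tsum_le_tsum fun i => ?_) (ENNReal.tsum_comp_le_tsum_of_injective hinj _)
  rw [← mul_assoc, geomWeight, ofReal_two_rpow_mul, ofReal_two_rpow_mul]
  gcongr
  · norm_num
  push_cast
  have h1 : |((k : ℝ) - 4 + i - k)| ≤ i + 4 := by
    rw [abs_le]; constructor <;> linarith [(i.cast_nonneg : (0 : ℝ) ≤ i)]
  have h2 : δ * |((k : ℝ) - 4 + i - k)| ≤ s * (i + 4) := by
    have : (0 : ℝ) ≤ i := i.cast_nonneg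
    have := hδ.le.trans hδs
    gcongr
  linarith

lemma dyadic_large_scale_le {s α δ r d : ℝ} {k l : ℤ} (hα : 0 ≤ α)
    (hδ : δ ≤ 1 - s - α) (hl : (2 : ℝ) ^ (-l - 1) ≤ r) (hl' : r < (2 : ℝ) ^ (-l))
    (hk : (2 : ℝ) ^ (-k) ≤ r) (hd' : d ≤ (2 : ℝ) ^ (-k)) (h : ℤ → ℝ≥0∞) :
    ENNReal.ofReal (r ^ α) * (ENNReal.ofReal (d / r) *
        (ENNReal.ofReal (2 ^ (-((l - 4 : ℤ) * s))) * h (l - 4))) ≤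
      32 * ENNReal.ofReal (2 ^ (-(k * (s + α)))) * ∑' m, geomWeight δ (m - k) * h m := by
  have hr : 0 < r := lt_of_lt_of_le (by positivity) hl
  have hlk : l < k := by
    have := (zpow_lt_zpow_iff_right₀ (one_lt_two (α := ℝ))).1 (hk.trans_lt hl')
    omega
  have hlk' : (l : ℝ) + 1 ≤ k := by exact_mod_cast hlk
  have h1 : r ^ α ≤ 2 ^ (-(l * α)) := by
    rw [← two_zpow_neg_rpow]
    gcongr
  have h2 : d / r ≤ 2 ^ ((l : ℝ) + 1 - k) := by
    calc d / r ≤ (2 : ℝ) ^ (-k) / (2 : ℝ) ^ (-l - 1) := by gcongr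
      _ = _ := by
        rw [← zpow_sub₀ (by norm_num), ← Real.rpow_intCast]; push_cast; congr 1; ring
  refine le_trans ?_ (mul_le_mul_right (ENNReal.le_tsum (l - 4)) _)
  have e32 : (32 : ℝ≥0∞) = ENNReal.ofReal (2 ^ (5 : ℝ)) := by norm_num
  calc _ ≤ ENNReal.ofReal (2 ^ (-(l * α))) * (ENNReal.ofReal (2 ^ ((l : ℝ) + 1 - k)) *
        (ENNReal.ofReal (2 ^ (-((l - 4 : ℤ) * s))) * h (l - 4))) := by gcongr
    _ ≤ _ := by
      simp only [e32, geomWeight, ← mul_assoc, ofReal_two_rpow_mul]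
      refine mul_le_mul' (ENNReal.ofReal_le_ofReal
        (Real.rpow_le_rpow_of_exponent_le one_le_two ?_)) le_rfl
      push_cast
      have h3 : |((l : ℝ) - 4 - k)| = k + 4 - l := by
        rw [abs_of_neg (by linarith)]; ring
      rw [h3]
      nlinarith [mul_le_mul_of_nonneg_right hδ (show (0 : ℝ) ≤ k + 4 - l by linarith)]

/-- Weighted sum of `H m x` concentrated around the level `k`. -/
noncomputable def levelSum (δ : ℝ) (H : ℤ → X → ℝ≥0∞) (k : ℤ) (x : X) : ℝ≥0∞ :=
  ∑' m, geomWeight δ (m - k) * H m x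

lemma tsum_nat_le_levelSum {s δ : ℝ} {H : ℤ → X → ℝ≥0∞} (hδ : 0 < δ) (hδs : δ ≤ s) (A : ℝ≥0∞) (x : X) (k : ℤ) :
    ∑' i : ℕ, A * (ENNReal.ofReal (2 ^ (-((k - 4 + i : ℤ) * s))) * H (k - 4 + i) x) ≤
      A * (ENNReal.ofReal (2 ^ (8 * s)) * ENNReal.ofReal (2 ^ (-(k * s))) * levelSum δ H k x) := by
  rw [ENNReal.tsum_mul_left]
  gcongr
  exact tsum_nat_two_rpow_mul_le hδ hδs (fun m => H m x) k

section Maximal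

variable [PseudoMetricSpace X] [MeasurableSpace X] {μ : Measure X} {u : X → ℝ}
  {b : X → ℤ → ℝ≥0∞} {A : ℝ≥0∞} {s α δ : ℝ} {H : ℤ → X → ℝ≥0∞}

lemma IsOscBound.rpow_mul_dConv_le_of_lt
    (hb : IsOscBound μ u b fun x m => A * (ENNReal.ofReal (2 ^ (-(m * s))) * H m x))
    (D : DiscreteMaxData X) (hα : 0 ≤ α) (hδ : 0 < δ) (hδs : δ ≤ s) {r : ℚ} (hr : 0 < r) {k : ℤ}
    (hk : r < (2 : ℝ) ^ (-k)) {x y : X} (hxy : dist x y < (2 : ℝ) ^ (-k)) :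
    ENNReal.ofReal ((r : ℝ) ^ α) * D.dConv μ u r x ≤
      ENNReal.ofReal ((r : ℝ) ^ α) * D.dConv μ u r y +
        4 * A * ENNReal.ofReal (2 ^ (8 * s)) * ENNReal.ofReal (2 ^ (-(k * (s + α)))) *
          (levelSum δ H k x + levelSum δ H k y) := by
  have hr' : (0 : ℝ) < r := by exact_mod_cast hr
  have h := hb.dConv_le_of_lt D hr hk hxy
  have hx := tsum_nat_le_levelSum (H := H) hδ hδs A x k
  have hy := tsum_nat_le_levelSum (H := H) hδ hδs A y k
  have hrα : ENNReal.ofReal ((r : ℝ) ^ α) ≤ ENNReal.ofReal (2 ^ (-(k * α))) := by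
    rw [← two_zpow_neg_rpow]; gcongr
  have e : ENNReal.ofReal (2 ^ (-(k * (s + α)))) =
      ENNReal.ofReal (2 ^ (-(k * α))) * ENNReal.ofReal (2 ^ (-(k * s))) := by
    rw [ofReal_two_rpow_mul]; congr 2; ring
  calc _ ≤ ENNReal.ofReal ((r : ℝ) ^ α) * (D.dConv μ u r y + 4 * (
        A * (ENNReal.ofReal (2 ^ (8 * s)) * ENNReal.ofReal (2 ^ (-(k * s))) * levelSum δ H k x) +
        A * (ENNReal.ofReal (2 ^ (8 * s)) * ENNReal.ofReal (2 ^ (-(k * s))) *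
          levelSum δ H k y))) := by
        gcongr; exact h.trans (by gcongr)
    _ ≤ ENNReal.ofReal ((r : ℝ) ^ α) * D.dConv μ u r y + ENNReal.ofReal (2 ^ (-(k * α))) * (4 * (
        A * (ENNReal.ofReal (2 ^ (8 * s)) * ENNReal.ofReal (2 ^ (-(k * s))) * levelSum δ H k x) +
        A * (ENNReal.ofReal (2 ^ (8 * s)) * ENNReal.ofReal (2 ^ (-(k * s))) *
          levelSum δ H k y))) := by
        rw [mul_add]; gcongr
    _ = _ := by rw [e]; ring

lemma IsOscBound.rpow_mul_dConv_le_of_le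
    (hb : IsOscBound μ u b fun x m => A * (ENNReal.ofReal (2 ^ (-(m * s))) * H m x))
    (D : DiscreteMaxData X) (hα : 0 ≤ α) (hδ : δ ≤ 1 - s - α) {r : ℚ} (hr : 0 < r) {k : ℤ}
    (hk : (2 : ℝ) ^ (-k) ≤ r) {x y : X} (hxy : dist x y < (2 : ℝ) ^ (-k)) :
    ENNReal.ofReal ((r : ℝ) ^ α) * D.dConv μ u r x ≤
      ENNReal.ofReal ((r : ℝ) ^ α) * D.dConv μ u r y +
        128 * ENNReal.ofReal D.L * D.N * A * ENNReal.ofReal (2 ^ (-(k * (s + α)))) *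
          levelSum δ H k x := by
  have hr' : (0 : ℝ) < r := by exact_mod_cast hr
  obtain ⟨l, hl, hl'⟩ := exists_dyadic_level hr'
  have h := hb.dConv_le_of_le D hr hl hl' (hxy.le.trans hk)
  have h2 := dyadic_large_scale_le hα hδ hl hl' hk hxy.le (fun m => H m x)
  have e : ENNReal.ofReal (D.L / r * dist x y) =
      ENNReal.ofReal D.L * ENNReal.ofReal (dist x y / r) := by
    rw [← ENNReal.ofReal_mul D.L_pos.le]; congr 1; ring
  calc _ ≤ _ := mul_le_mul_right h _
    _ = ENNReal.ofReal ((r : ℝ) ^ α) * D.dConv μ u r y +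
        4 * ENNReal.ofReal D.L * D.N * A * (ENNReal.ofReal ((r : ℝ) ^ α) *
        (ENNReal.ofReal (dist x y / r) *
          (ENNReal.ofReal (2 ^ (-((l - 4 : ℤ) * s))) * H (l - 4) x))) := by
        rw [e]; ring
    _ ≤ ENNReal.ofReal ((r : ℝ) ^ α) * D.dConv μ u r y +
        4 * ENNReal.ofReal D.L * D.N * A * (32 * ENNReal.ofReal (2 ^ (-(k * (s + α)))) *
          levelSum δ H k x) := add_le_add_right (mul_le_mul_right h2 _) _
    _ = _ := by ring

lemma IsOscBound.dMax_le
    (hb : IsOscBound μ u b fun x m => A * (ENNReal.ofReal (2 ^ (-(m * s))) * H m x))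
    (D : DiscreteMaxData X) (hα : 0 ≤ α) (hδ : 0 < δ) (hδs : δ ≤ s) (hδ' : δ ≤ 1 - s - α) {k : ℤ}
    {x y : X} (hxy : dist x y < (2 : ℝ) ^ (-k)) :
    D.dMax μ α u x ≤ D.dMax μ α u y +
      (4 * A * ENNReal.ofReal (2 ^ (8 * s)) + 128 * ENNReal.ofReal D.L * D.N * A) *
        ENNReal.ofReal (2 ^ (-(k * (s + α)))) * (levelSum δ H k x + levelSum δ H k y) := by
  refine iSup₂_le fun r hr => ?_
  have hy : ENNReal.ofReal ((r : ℝ) ^ α) * D.dConv μ u r y ≤ D.dMax μ α u y :=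
    le_iSup₂ (f := fun (r : ℚ) (_ : 0 < r) => ENNReal.ofReal ((r : ℝ) ^ α) * D.dConv μ u r y) r hr
  rcases lt_or_ge (r : ℝ) ((2 : ℝ) ^ (-k)) with hk | hk
  · refine (hb.rpow_mul_dConv_le_of_lt D hα hδ hδs hr hk hxy).trans ?_
    gcongr
    exact le_self_add
  · refine (hb.rpow_mul_dConv_le_of_le D hα hδ' hr hk hxy).trans ?_
    gcongr
    · exact le_add_self
    · exact le_self_add

lemma IsOscBound.dMax_ne_top
    (hb : IsOscBound μ u b fun x m => A * (ENNReal.ofReal (2 ^ (-(m * s))) * H m x))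
    (hA : A ≠ ⊤)
    (D : DiscreteMaxData X) (hα : 0 ≤ α) (hδ : 0 < δ) (hδs : δ ≤ s) (hδ' : δ ≤ 1 - s - α)
    {x y : X} (hy : D.dMax μ α u y ≠ ⊤) (hx : ∀ k, levelSum δ H k x ≠ ⊤) :
    D.dMax μ α u x ≠ ⊤ := by
  obtain ⟨k, hk⟩ : ∃ k : ℤ, dist x y < (2 : ℝ) ^ (-k) := by
    obtain ⟨n, hn⟩ := pow_unbounded_of_one_lt (dist x y) (one_lt_two (α := ℝ))
    exact ⟨-n, by simpa using hn⟩
  have hb_top := (hb x (k - 4)).1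
  have hS : ∑' i : ℕ, A * (ENNReal.ofReal (2 ^ (-((k - 4 + i : ℤ) * s))) * H (k - 4 + i) x) ≠ ⊤ :=
    ne_top_of_le_ne_top (ENNReal.mul_ne_top hA (ENNReal.mul_ne_top (ENNReal.mul_ne_top
      ENNReal.ofReal_ne_top ENNReal.ofReal_ne_top) (hx k)))
      (tsum_nat_le_levelSum (H := H) hδ hδs A x k)
  set S := ∑' i : ℕ, A * (ENNReal.ofReal (2 ^ (-((k - 4 + i : ℤ) * s))) * H (k - 4 + i) x) with hS'
  have hbound : D.dMax μ α u x ≤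
      ENNReal.ofReal (((2 : ℝ) ^ (-k)) ^ α) * (b x (k - 4) + 3 * S) + (D.dMax μ α u y +
        128 * ENNReal.ofReal D.L * D.N * A * ENNReal.ofReal (2 ^ (-(k * (s + α)))) *
          levelSum δ H k x) := by
    refine iSup₂_le fun r hr => ?_
    have hr' : (0 : ℝ) < r := by exact_mod_cast hr
    have hy : ENNReal.ofReal ((r : ℝ) ^ α) * D.dConv μ u r y ≤ D.dMax μ α u y :=
      le_iSup₂ (f := fun (r : ℚ) (_ : 0 < r) => ENNReal.ofReal ((r : ℝ) ^ α) * D.dConv μ u r y)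
        r hr
    rcases lt_or_ge (r : ℝ) ((2 : ℝ) ^ (-k)) with hrk | hrk
    · refine le_trans ?_ le_self_add
      exact mul_le_mul' (ENNReal.ofReal_le_ofReal (by gcongr))
        (hb.dConv_le_and_le_of_le D hr hrk x).1
    · refine le_trans ?_ le_add_self
      refine (hb.rpow_mul_dConv_le_of_le D hα hδ' hr hrk hk).trans ?_
      gcongr
  refine ne_top_of_le_ne_top ?_ hbound
  have := hx k
  finiteness

end Maximal

lemma eLpNorm_ofReal_rpow [MeasurableSpace X] {μ : Measure X} {p q : ℝ} (hp : 0 < p)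
    (f : X → ℝ) :
    eLpNorm f (ENNReal.ofReal p) μ ^ q = (∫⁻ x, ‖f x‖ₑ ^ p ∂μ) ^ (q / p) := by
  rw [eLpNorm_eq_lintegral_rpow_enorm_toReal (by simpa using hp) ENNReal.ofReal_ne_top,
    ENNReal.toReal_ofReal hp.le, ← ENNReal.rpow_mul]
  congr 1; ring

/-- Discrete Young inequality in `ℓ^P` for geometric weights. -/
lemma exists_tsum_rpow_le_of_le_tsum_geomWeight {δ P : ℝ} (hδ : 0 < δ) (hP : 0 < P) {C : ℝ≥0∞}
    (hC : C ≠ ⊤) :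
    ∃ C' : ℝ≥0∞, C' ≠ ⊤ ∧ ∀ a b : ℤ → ℝ≥0∞,
      (∀ k, b k ≤ C * ∑' j, geomWeight δ (j - k) * a j) → ∑' k, b k ^ P ≤ C' * ∑' j, a j ^ P := by
  obtain ⟨C₁, hC₁, h₁⟩ := exists_tsum_geomWeight_rpow_le hδ hP
  have hδP : 0 < δ / 2 * P := by positivity
  refine ⟨C ^ P * C₁ * ∑' n, geomWeight (δ / 2 * P) n,
    ENNReal.mul_ne_top (ENNReal.mul_ne_top (ENNReal.rpow_ne_top_of_nonneg hP.le hC) hC₁)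
      (tsum_geomWeight_ne_top hδP), fun a b hab => ?_⟩
  calc ∑' k, b k ^ P
      ≤ ∑' k, C ^ P * C₁ * ∑' j, geomWeight (δ / 2 * P) (j - k) * a j ^ P := by
        refine ENNReal.tsum_le_tsum fun k => ?_
        calc b k ^ P ≤ (C * ∑' j, geomWeight δ (j - k) * a j) ^ P := by gcongr; exact hab k
          _ = C ^ P * (∑' j, geomWeight δ (j - k) * a j) ^ P := ENNReal.mul_rpow_of_nonneg _ _ hP.le
          _ ≤ _ := by rw [mul_assoc]; gcongr; exact h₁ a k
    _ = C ^ P * C₁ * ∑' j, ∑' k, geomWeight (δ / 2 * P) (j - k) * a j ^ P := by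
        rw [ENNReal.tsum_mul_left, ENNReal.tsum_comm]
    _ = _ := by
        simp_rw [ENNReal.tsum_mul_right, tsum_geomWeight_sub', ENNReal.tsum_mul_left, mul_assoc]

lemma measurable_levelSum [MeasurableSpace X] (δ : ℝ) {H : ℤ → X → ℝ≥0∞}
    (hH : ∀ m, Measurable (H m)) (k : ℤ) : Measurable (levelSum δ H k) :=
  Measurable.tsum fun m => (hH m).const_mul _

lemma exists_tsum_lintegral_levelSum_rpow_le [MeasurableSpace X] {μ : Measure X} {δ δ' p q : ℝ}
    (hδ : 0 < δ) (hδ' : 0 < δ') (hp : 0 < p) (hq : 0 < q) {C : ℝ≥0∞} (hC : C ≠ ⊤) :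
    ∃ C' : ℝ≥0∞, C' ≠ ⊤ ∧ ∀ (H : ℤ → X → ℝ≥0∞) (a : ℤ → ℝ≥0∞), (∀ m, Measurable (H m)) →
      (∀ m, ∫⁻ x, H m x ^ p ∂μ ≤ C * ∑' j, geomWeight δ' (j - m) * a j) →
      ∑' k, (∫⁻ x, levelSum δ H k x ^ p ∂μ) ^ (q / p) ≤ C' * ∑' j, a j ^ (q / p) := by
  obtain ⟨C₁, hC₁, h₁⟩ := exists_tsum_geomWeight_rpow_le hδ hp
  set ε := min (δ / 2 * p) δ' with hε
  have hε0 : 0 < ε := lt_min (by positivity) hδ'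
  have hC₂ : C₁ * C * ∑' n, geomWeight (ε / 2) n ≠ ⊤ :=
    ENNReal.mul_ne_top (ENNReal.mul_ne_top hC₁ hC) (tsum_geomWeight_ne_top (half_pos hε0))
  obtain ⟨C', hC', h'⟩ := exists_tsum_rpow_le_of_le_tsum_geomWeight (half_pos hε0)
    (div_pos hq hp) hC₂
  refine ⟨C', hC', fun H a hH ha => h' a _ fun k => ?_⟩
  calc ∫⁻ x, levelSum δ H k x ^ p ∂μ
      ≤ ∫⁻ x, C₁ * ∑' m, geomWeight (δ / 2 * p) (m - k) * H m x ^ p ∂μ :=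
        lintegral_mono fun x => h₁ (fun m => H m x) k
    _ = C₁ * ∑' m, geomWeight (δ / 2 * p) (m - k) * ∫⁻ x, H m x ^ p ∂μ := by
        rw [lintegral_const_mul' _ _ hC₁, lintegral_tsum
          fun m => (((hH m).pow_const p).const_mul _).aemeasurable]
        simp_rw [lintegral_const_mul' _ _ (geomWeight_ne_top _ _)]
    _ ≤ C₁ * ∑' m, geomWeight ε (m - k) * (C * ∑' j, geomWeight ε (j - m) * a j) := by
        gcongr with m
        · exact geomWeight_anti (min_le_left _ _) _
        · refine (ha m).trans ?_
          gcongr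
          exact geomWeight_anti (min_le_right _ _) _
    _ = C₁ * C * ∑' m, geomWeight ε (m - k) * ∑' j, geomWeight ε (j - m) * a j := by
        simp_rw [mul_left_comm _ C, ENNReal.tsum_mul_left, mul_assoc]
    _ ≤ C₁ * C * ((∑' n, geomWeight (ε / 2) n) * ∑' j, geomWeight (ε / 2) (j - k) * a j) := by
        gcongr; exact tsum_tsum_geomWeight_le hε0 a k
    _ = _ := by rw [mul_assoc (C₁ * C)]

/-- A function whose variation at every dyadic scale is controlled by a finite function `G k` has
the multiples of `G k` as a fractional gradient. -/
lemma isFracHajlaszGradient_toReal [PseudoMetricSpace X] [MeasurableSpace X] {μ : Measure X}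
    {s : ℝ} (hs : 0 < s) {A : ℝ≥0∞} (hA : A ≠ ⊤) {M : X → ℝ≥0∞} {G : ℤ → X → ℝ≥0∞}
    (hG : ∀ k, Measurable (G k)) (hGtop : ∀ k, ∀ᵐ x ∂μ, G k x ≠ ⊤)
    (hMtop : ∀ x, (∀ k, G k x ≠ ⊤) → M x ≠ ⊤)
    (hM : ∀ (k : ℤ) (x y : X), dist x y < (2 : ℝ) ^ (-k) →
      M x ≤ M y + A * ENNReal.ofReal (2 ^ (-(k * s))) * (G k x + G k y)) :
    IsFracHajlaszGradient μ s (fun x => (M x).toReal)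
      (fun k x => (A * ENNReal.ofReal (2 ^ s) * G k x).toReal) := by
  refine ⟨fun k => ((hG k).const_mul _).ennreal_toReal, fun k x => ENNReal.toReal_nonneg,
    {x | ∀ k, G k x ≠ ⊤}ᶜ, ae_all_iff.2 hGtop, fun k x hx y hy hd hd' => ?_⟩
  simp only [Set.mem_compl_iff, not_not, Set.mem_ofPred_eq] at hx hy
  have key : ∀ x y : X, (∀ k, G k x ≠ ⊤) → (∀ k, G k y ≠ ⊤) → (2 : ℝ) ^ (-k - 1) ≤ dist x y →
      dist x y < (2 : ℝ) ^ (-k) → (M x).toReal ≤ (M y).toReal + dist x y ^ s *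
        ((A * ENNReal.ofReal (2 ^ s) * G k x).toReal +
          (A * ENNReal.ofReal (2 ^ s) * G k y).toReal) := by
    intro x y hx hy hd hd'
    have hx' := hx k
    have hy' := hy k
    have hMy := hMtop y hy
    have h : M x ≤ M y + ENNReal.ofReal (dist x y ^ s) *
        (A * ENNReal.ofReal (2 ^ s) * G k x + A * ENNReal.ofReal (2 ^ s) * G k y) := by
      refine (hM k x y hd').trans ?_
      have hpow : (2 : ℝ) ^ (-(k * s)) ≤ dist x y ^ s * 2 ^ s := by
        rw [← two_zpow_neg_rpow, ← Real.mul_rpow dist_nonneg (by norm_num)]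
        refine Real.rpow_le_rpow (by positivity) ?_ hs.le
        have e2 : (2 : ℝ) ^ (-k) = 2 * 2 ^ (-k - 1) := by
          rw [← zpow_one_add₀ (by norm_num)]; congr 1; ring
        linarith
      calc _ ≤ M y + A * ENNReal.ofReal (dist x y ^ s * 2 ^ s) * (G k x + G k y) := by gcongr
        _ = _ := by rw [ENNReal.ofReal_mul (by positivity)]; ring
    have := ENNReal.toReal_mono (by finiteness) h
    rwa [ENNReal.toReal_add hMy (by finiteness), ENNReal.toReal_mul,
      ENNReal.toReal_add (by finiteness) (by finiteness),
      ENNReal.toReal_ofReal (by positivity)] at this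
  rw [abs_le]
  have h1 := key x y hx hy hd hd'
  have h2 := key y x hy hx (by rwa [dist_comm]) (by rwa [dist_comm])
  rw [dist_comm y x] at h2
  constructor <;> linarith

lemma tsum_eLpNorm_toReal_rpow_le [MeasurableSpace X] {μ : Measure X} {p q : ℝ} (hp : 0 < p)
    (hq : 0 < q) {B : ℝ≥0∞} (hB : B ≠ ⊤) (G : ℤ → X → ℝ≥0∞) :
    ∑' k, eLpNorm (fun x => (B * G k x).toReal) (ENNReal.ofReal p) μ ^ q ≤
      B ^ q * ∑' k, (∫⁻ x, G k x ^ p ∂μ) ^ (q / p) := by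
  rw [← ENNReal.tsum_mul_left]
  refine ENNReal.tsum_le_tsum fun k => ?_
  rw [eLpNorm_ofReal_rpow hp]
  calc _ ≤ (∫⁻ x, B ^ p * G k x ^ p ∂μ) ^ (q / p) := by
        gcongr with x
        rw [← ENNReal.mul_rpow_of_nonneg _ _ hp.le]
        gcongr
        rw [Real.enorm_of_nonneg ENNReal.toReal_nonneg]
        exact ENNReal.ofReal_toReal_le
    _ = _ := by
        rw [lintegral_const_mul' _ _ (ENNReal.rpow_ne_top_of_nonneg hp.le hB),
          ENNReal.mul_rpow_of_nonneg _ _ (by positivity), ← ENNReal.rpow_mul,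
          mul_div_cancel₀ _ hp.ne']

theorem exists_besovNorm_dMax_le [MetricSpace X] [SecondCountableTopology X] [MeasurableSpace X]
    [BorelSpace X] {μ : Measure X} [SFinite μ] {c Q : ℝ} (hQ : 0 < Q) (hc : 0 < c)
    (hdim : DimLowerBound μ c Q) (h0 : ∀ (x : X) (r : ℝ), 0 < r → μ (ball x r) ≠ 0)
    (htop : ∀ (x : X) (r : ℝ), μ (ball x r) ≠ ⊤) (D : DiscreteMaxData X) {s α p q : ℝ}
    (hs : 0 < s) (hα : 0 ≤ α) (hsα : s + α < 1) (hp : Q / (Q + s) < p) (hq : 0 < q) :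
    ∃ C : ℝ≥0∞, C ≠ ⊤ ∧ ∀ u : X → ℝ, AEStronglyMeasurable u μ → (∃ x, D.dMax μ α u x ≠ ⊤) →
      ∀ g : ℤ → X → ℝ, IsFracHajlaszGradient μ s u g →
        (∑' k, eLpNorm (g k) (ENNReal.ofReal p) μ ^ q) ≠ ⊤ →
        besovNorm μ (s + α) p q (fun x => (D.dMax μ α u x).toReal) ≤
          C * (∑' k, eLpNorm (g k) (ENNReal.ofReal p) μ ^ q) ^ (1 / q) := by
  have hp0 : 0 < p := lt_trans (by positivity) hp
  obtain ⟨σ, hσ, hσs, hσp⟩ : ∃ σ, 0 < σ ∧ σ < s ∧ (1 + σ / Q)⁻¹ ≤ p := by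
    refine ⟨max (s / 2) (Q / p - Q), lt_max_of_lt_left (by positivity),
      max_lt (by linarith) ?_, ?_⟩
    · rw [div_lt_iff₀ (by positivity)] at hp
      rw [sub_lt_iff_lt_add, div_lt_iff₀ hp0]
      linarith
    · have h1 : 1 / p ≤ 1 + max (s / 2) (Q / p - Q) / Q := by
        have : (Q / p - Q) / Q ≤ max (s / 2) (Q / p - Q) / Q := by gcongr; exact le_max_right _ _
        have e : (Q / p - Q) / Q = 1 / p - 1 := by field_simp
        linarith
      rw [one_div] at h1
      exact inv_le_of_inv_le₀ hp0 h1
  set t := (1 + σ / Q)⁻¹ with ht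
  have ht0 : 0 < t := by positivity
  have hδ₀ : 0 < (s - σ) * t := mul_pos (by linarith) ht0
  obtain ⟨C₁, hC₁, hosc⟩ := exists_setLAverage_abs_sub_le hQ hc hσ hσs.le hdim h0 htop
  obtain ⟨C₂, hC₂, δ', hδ', hH⟩ :=
    exists_lintegral_gradAverage_rpow_le hQ hc hdim h0 htop hδ₀ ht0 hσp
  set δ := min s (1 - s - α)
  have hδ : 0 < δ := lt_min hs (by linarith)
  obtain ⟨C₃, hC₃, hsum⟩ := exists_tsum_lintegral_levelSum_rpow_le (X := X) (μ := μ) hδ hδ' hp0 hq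
    hC₂
  set A := ENNReal.ofReal (16 ^ Q / c) * ENNReal.ofReal C₁
  have hA : A ≠ ⊤ := by finiteness
  set K := 4 * A * ENNReal.ofReal (2 ^ (8 * s)) + 128 * ENNReal.ofReal D.L * D.N * A
  have hK : K ≠ ⊤ := by finiteness
  set B := K * ENNReal.ofReal (2 ^ (s + α))
  have hB : B ≠ ⊤ := by finiteness
  refine ⟨(B ^ q * C₃) ^ (1 / q), ENNReal.rpow_ne_top_of_nonneg (by positivity)
    (ENNReal.mul_ne_top (ENNReal.rpow_ne_top_of_nonneg hq.le hB) hC₃),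
    fun u hu ⟨x₀, hx₀⟩ g hg hfin => ?_⟩
  have hgm := hg.1
  choose a ha hβ using hosc u g hg
  set H := gradAverage μ ((s - σ) * t) t g
  have hHm : ∀ m, Measurable (H m) := measurable_gradAverage _ _ hgm
  have hb : IsOscBound μ u (fun x m => ENNReal.ofReal (a x m))
      fun x m => A * (ENNReal.ofReal (2 ^ (-(m * s))) * H m x) := by
    convert isOscBound_of_setLAverage_le hQ hc hdim h0 htop hu ha hβ using 3 with x m
    rw [ENNReal.ofReal_mul hC₁.le]
    ring
  have hgnorm : ∀ k, eLpNorm (g k) (ENNReal.ofReal p) μ ^ q =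
      (∫⁻ x, ENNReal.ofReal (g k x) ^ p ∂μ) ^ (q / p) := by
    intro k
    rw [eLpNorm_ofReal_rpow hp0]
    simp_rw [Real.enorm_of_nonneg (hg.2.1 k _)]
  have hG := hsum H _ hHm (hH g hgm)
  simp_rw [← hgnorm] at hG
  have hGfin : ∀ k, ∀ᵐ x ∂μ, levelSum δ H k x ≠ ⊤ := by
    intro k
    have h1 : (∫⁻ x, levelSum δ H k x ^ p ∂μ) ^ (q / p) ≠ ⊤ :=
      ne_top_of_le_ne_top (ENNReal.mul_ne_top hC₃ hfin) ((ENNReal.le_tsum k).trans hG)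
    have h2 : ∫⁻ x, levelSum δ H k x ^ p ∂μ ≠ ⊤ := by
      intro h
      exact h1 (by rw [h, ENNReal.top_rpow_of_pos (by positivity)])
    filter_upwards [ae_lt_top ((measurable_levelSum δ hHm k).pow_const p) h2] with x hx h
    rw [h, ENNReal.top_rpow_of_pos hp0] at hx
    exact lt_irrefl _ hx
  have hgrad : IsFracHajlaszGradient μ (s + α) (fun x => (D.dMax μ α u x).toReal)
      (fun k x => (B * levelSum δ H k x).toReal) :=
    isFracHajlaszGradient_toReal (by linarith) hK (measurable_levelSum δ hHm) hGfin
      (fun x hx => hb.dMax_ne_top hA D hα hδ (min_le_left _ _) (min_le_right _ _) hx₀ hx)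
      (fun k x y hxy => hb.dMax_le D hα hδ (min_le_left _ _) (min_le_right _ _) hxy)
  refine (iInf₂_le _ hgrad).trans ?_
  rw [← ENNReal.mul_rpow_of_nonneg _ _ (by positivity)]
  gcongr
  calc _ ≤ _ := tsum_eLpNorm_toReal_rpow_le hp0 hq hB _
    _ ≤ B ^ q * (C₃ * _) := mul_le_mul_right hG _
    _ = _ := by rw [mul_assoc]

lemma besovNorm_eq_zero [PseudoMetricSpace X] [MeasurableSpace X] {μ : Measure X} {s p q : ℝ}
    (hq : 0 < q) {u : X → ℝ} (hu : IsFracHajlaszGradient μ s u 0) : besovNorm μ s p q u = 0 := by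
  refine le_antisymm ((iInf₂_le _ hu).trans ?_) zero_le
  simp [hq]

lemma measure_eq_zero_of_measure_ball_eq_zero [PseudoMetricSpace X] [MeasurableSpace X]
    {μ : Measure X} {c Q : ℝ} (hc : 0 < c) (hdim : DimLowerBound μ c Q) {x : X} {r : ℝ}
    (hr : 0 < r) (h : μ (ball x r) = 0) : μ = 0 := by
  rw [← Measure.measure_univ_eq_zero, ← iUnion_ball_nat x, measure_iUnion_null_iff]
  intro n
  refine measure_mono_null (ball_subset_ball (le_max_left (n : ℝ) r)) ?_
  have hR : 0 < max (n : ℝ) r := lt_max_of_lt_right hr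
  have := hdim x x r _ hr (le_max_right (n : ℝ) r) (mem_ball_self hR)
  rw [h, nonpos_iff_eq_zero, mul_eq_zero] at this
  refine this.resolve_left ?_
  have : 0 < c * (r / max (n : ℝ) r) ^ Q := by positivity
  simpa using this

lemma measure_ball_eq_top_of_measure_ball_eq_top [PseudoMetricSpace X] [MeasurableSpace X]
    {μ : Measure X} {c Q : ℝ} (hc : 0 < c) (hdim : DimLowerBound μ c Q) {x : X} {r : ℝ}
    (h : μ (ball x r) = ⊤) (y : X) {ρ : ℝ} (hρ : 0 < ρ) : μ (ball y ρ) = ⊤ := by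
  have hR : 0 < max ρ (r + dist x y) := lt_max_of_lt_left hρ
  have h1 : μ (ball y (max ρ (r + dist x y))) = ⊤ :=
    measure_mono_top (ball_subset_ball' (le_max_right _ _)) h
  have h2 := hdim y y ρ _ hρ (le_max_left _ _) (mem_ball_self hR)
  have : 0 < c * (ρ / max ρ (r + dist x y)) ^ Q := by positivity
  rwa [h1, ENNReal.mul_top (by simpa using this), top_le_iff] at h2

lemma DiscreteMaxData.dMax_eq_zero [PseudoMetricSpace X] [MeasurableSpace X]
    (D : DiscreteMaxData X) {μ : Measure X} (h : ∀ (x : X) (r : ℝ), 0 < r → μ (ball x r) = ⊤)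
    (α : ℝ) (u : X → ℝ) (x : X) : D.dMax μ α u x = 0 := by
  refine le_antisymm (iSup₂_le fun r hr => ?_) zero_le
  have hr' : (0 : ℝ) < r := by exact_mod_cast hr
  simp [setLAverage_eq, h _ _ (mul_pos three_pos hr')]

lemma DiscreteMaxData.separableSpace [PseudoMetricSpace X] (D : DiscreteMaxData X) :
    TopologicalSpace.SeparableSpace X := by
  refine ⟨⟨Set.range fun z : ℚ × ℕ => D.center z.1 z.2, Set.countable_range _, ?_⟩⟩
  refine Metric.dense_iff.2 fun x r hr => ?_
  obtain ⟨ρ, hρ, hρr⟩ := exists_rat_btwn hr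
  obtain ⟨i, hi⟩ := D.cover ρ (by exact_mod_cast hρ) x
  exact ⟨D.center ρ i, mem_ball.2 ((mem_ball'.1 hi).trans hρr), (ρ, i), rfl⟩

theorem statement15 [MetricSpace X] [MeasurableSpace X] [BorelSpace X] (μ : Measure X)
    (c_d : ℝ≥0∞) (hdoub : IsDoubling μ c_d) (Q : ℝ) (hQ : 1 < Q)
    (c_Q : ℝ) (hcQ : 0 < c_Q) (hdim : DimLowerBound μ c_Q Q)
    (D : DiscreteMaxData X)
    (s α p q : ℝ) (hs : 0 < s) (hα : 0 ≤ α) (hsα0 : 0 < s + α) (hsα1 : s + α < 1)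
    (hp : Q / (Q + s) < p) (hq : 0 < q) :
    ∃ C : ℝ, 0 < C ∧ ∀ u : X → ℝ, LocallyIntegrable u μ → besovNorm μ s p q u ≠ ⊤ →
      (∃ x, D.dMax μ α u x ≠ ⊤) →
      besovNorm μ (s + α) p q (fun x => (D.dMax μ α u x).toReal) ≤
        ENNReal.ofReal C * besovNorm μ s p q u := by
  by_cases h0 : ∀ (x : X) (r : ℝ), 0 < r → μ (ball x r) ≠ 0
  swap
  · push Not at h0
    obtain ⟨x, r, hr, h⟩ := h0
    obtain rfl := measure_eq_zero_of_measure_ball_eq_zero hcQ hdim hr h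
    refine ⟨1, one_pos, fun u _ _ _ => ?_⟩
    rw [besovNorm_eq_zero hq ⟨fun _ => measurable_const, fun _ _ => le_rfl, Set.univ, by simp,
      fun _ x hx => absurd (Set.mem_univ x) hx⟩]
    exact zero_le
  by_cases htop : ∀ (x : X) (r : ℝ), μ (ball x r) ≠ ⊤
  swap
  · push Not at htop
    obtain ⟨x, r, h⟩ := htop
    refine ⟨1, one_pos, fun u _ _ _ => ?_⟩
    simp_rw [D.dMax_eq_zero
      (fun y ρ hρ => measure_ball_eq_top_of_measure_ball_eq_top hcQ hdim h y hρ)]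
    rw [besovNorm_eq_zero hq ⟨fun _ => measurable_const, fun _ _ => le_rfl, ∅, by simp,
      fun _ x _ y _ _ _ => by simp⟩]
    exact zero_le
  have := D.separableSpace
  have := UniformSpace.secondCountable_of_separable X
  have : IsLocallyFiniteMeasure μ :=
    ⟨fun x => ⟨ball x 1, ball_mem_nhds x one_pos, (htop x 1).lt_top⟩⟩
  obtain ⟨C, hC, h⟩ := exists_besovNorm_dMax_le (by linarith) hcQ hdim h0 htop D hs hα hsα1 hp hq
  refine ⟨C.toReal + 1, by positivity, fun u hu _ hx => ?_⟩
  have hCle : C ≤ ENNReal.ofReal (C.toReal + 1) :=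
    (ENNReal.le_ofReal_iff_toReal_le hC (by positivity)).2 (by linarith)
  have hC0 : ENNReal.ofReal (C.toReal + 1) ≠ 0 := by
    have : 0 < C.toReal + 1 := by positivity
    simpa using this
  conv_rhs => rw [besovNorm]
  simp_rw [ENNReal.mul_iInf_of_ne hC0 ENNReal.ofReal_ne_top]
  refine le_iInf₂ fun g hg => ?_
  by_cases hfin : ∑' k, eLpNorm (g k) (ENNReal.ofReal p) μ ^ q = ⊤
  · rw [hfin, ENNReal.top_rpow_of_pos (by positivity), ENNReal.mul_top hC0]
    exact le_top
  · exact (h u hu.aestronglyMeasurable hx g hg hfin).trans (by gcongr)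

end FracMaximal
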